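/- arXiv:1610.01510 — 5 statements merged into one kernel-verified Lean document; each statement's English description precedes it below -/
import Mathlib

section
/- Let G be a finite group and let p be a prime dividing the order of G. Then the number of isomorphism classes of simple F_p[G]-modules is at least the sum, over all isomorphism classes of p-special irreducible complex representations φ of G, of the rational number t_φ / m_φ, where E_φ is the subfield of ℂ generated over ℚ by the values of the character of φ, m_φ = [E_φ : ℚ], and t_φ is the number of prime ideals of the integral closure of ℤ in E_φ lying over p. -/
open CategoryTheory

def FDRep.repKer {G : Type} [Group G] (V : FDRep ℂ G) : Subgroup G where
  carrier := {g : G | V.ρ g = 1}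
  one_mem' := by simp [map_one]
  mul_mem' := by
    intro a b ha hb
    simp only [Set.mem_setOf_eq] at *
    rw [map_mul, ha, hb, one_mul]
  inv_mem' := by
    intro a ha
    simp only [Set.mem_setOf_eq] at *
    have h := map_mul V.ρ a⁻¹ a
    rw [ha, mul_one, inv_mul_cancel, map_one] at h
    exact h.symm

instance {G : Type} [Group G] (V : FDRep ℂ G) : (V.repKer).Normal := by
  constructor
  intro a ha g
  show V.ρ (g * a * g⁻¹) = 1
  have ha' : V.ρ a = 1 := ha
  rw [map_mul, map_mul, ha', mul_one, ← map_mul, mul_inv_cancel, map_one]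


/-- `ω_φ = |G| / (|ker φ| * dim φ)`, the order of `G/ker φ` divided by the dimension. -/
noncomputable def FDRep.omega {G : Type} [Group G] [Fintype G] (V : FDRep ℂ G) : ℕ :=
  Fintype.card G / (Nat.card V.repKer * Module.finrank ℂ V)

/-- A representation is `p`-special if `p` does not divide `ω_φ`. -/
noncomputable def FDRep.IsPSpecial {G : Type} [Group G] [Fintype G] (p : ℕ) (V : FDRep ℂ G) : Prop :=
  ¬ p ∣ V.omega

/-- The character field `E_φ ⊆ ℂ`: the subfield generated over `ℚ` by the character values. -/
noncomputable def FDRep.charField {G : Type} [Group G] (V : FDRep ℂ G) :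
    IntermediateField ℚ ℂ :=
  IntermediateField.adjoin ℚ (Set.range V.character)

/-- `t_φ`: the number of prime ideals of the integral closure of `ℤ` in `E_φ` lying over `p`. -/
noncomputable def FDRep.numPrimesOver {G : Type} [Group G] (p : ℕ) (V : FDRep ℂ G) : ℕ :=
  Nat.card {P : Ideal (integralClosure ℤ V.charField) //
    P.IsPrime ∧ (p : integralClosure ℤ V.charField) ∈ P}


namespace PSp

/-- A linear map intertwining two representations gives a morphism. -/
noncomputable def mkHom {k G : Type} [Field k] [Group G] {V W : FDRep k G} (f : V →ₗ[k] W)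
    (hf : ∀ g v, f (V.ρ g v) = W.ρ g (f v)) : V ⟶ W :=
  ⟨InducedCategory.homMk (ModuleCat.ofHom f), fun g => by
    ext v
    exact hf g v⟩

noncomputable def toLin {k G : Type} [Field k] [Group G] {V W : FDRep k G} (f : V ⟶ W) : V →ₗ[k] W :=
  f.hom.hom.hom

lemma toLin_mkHom {k G : Type} [Field k] [Group G] {V W : FDRep k G} (f : V →ₗ[k] W)
    (hf : ∀ g v, f (V.ρ g v) = W.ρ g (f v)) : toLin (mkHom f hf) = f := rfl

lemma toLin_comm {k G : Type} [Field k] [Group G] {V W : FDRep k G} (f : V ⟶ W) (g : G) (v : V) :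
    toLin f (V.ρ g v) = W.ρ g (toLin f v) :=
  ConcreteCategory.congr_hom ((forget (FGModuleCat k)).congr_map (f.comm g)) v

lemma toLin_inj {k G : Type} [Field k] [Group G] {V W : FDRep k G} {f g : V ⟶ W}
    (h : toLin f = toLin g) : f = g := by
  apply Action.hom_ext
  ext v
  exact LinearMap.congr_fun h v

lemma toLin_comp {k G : Type} [Field k] [Group G] {U V W : FDRep k G} (f : U ⟶ V) (g : V ⟶ W) :
    toLin (f ≫ g) = toLin g ∘ₗ toLin f := rfl

lemma toLin_id {k G : Type} [Field k] [Group G] (V : FDRep k G) :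
    toLin (𝟙 V) = LinearMap.id := rfl

lemma toLin_zero {k G : Type} [Field k] [Group G] (V W : FDRep k G) :
    toLin (0 : V ⟶ W) = 0 := rfl

lemma isIso_of_bij {k G : Type} [Field k] [Group G] {V W : FDRep k G} (f : V ⟶ W)
    (h : Function.Bijective (toLin f)) : IsIso f := by
  let e := LinearEquiv.ofBijective (toLin f) h
  have he : ∀ v, e v = toLin f v := fun v => rfl
  refine ⟨mkHom e.symm.toLinearMap ?_, ?_, ?_⟩
  · intro g v
    apply e.injective
    simp only [LinearEquiv.coe_coe, LinearEquiv.apply_symm_apply]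
    rw [he, toLin_comm, ← he, LinearEquiv.apply_symm_apply]
  · apply toLin_inj
    rw [toLin_comp, toLin_mkHom, toLin_id]
    ext v
    exact e.symm_apply_apply v
  · apply toLin_inj
    rw [toLin_comp, toLin_mkHom, toLin_id]
    ext v
    exact e.apply_symm_apply v

lemma bij_of_isIso {k G : Type} [Field k] [Group G] {V W : FDRep k G} (f : V ⟶ W) [IsIso f] :
    Function.Bijective (toLin f) := by
  have h1 : toLin (inv f) ∘ₗ toLin f = LinearMap.id := by
    rw [← toLin_comp, IsIso.hom_inv_id, toLin_id]
  have h2 : toLin f ∘ₗ toLin (inv f) = LinearMap.id := by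
    rw [← toLin_comp, IsIso.inv_hom_id, toLin_id]
  exact ⟨Function.LeftInverse.injective (g := toLin (inv f)) fun v => LinearMap.congr_fun h1 v,
    Function.RightInverse.surjective (g := toLin (inv f)) fun v => LinearMap.congr_fun h2 v⟩

/-- The subrepresentation on an invariant subspace. -/
noncomputable def subRep {k G V : Type} [Field k] [Group G] [AddCommGroup V] [Module k V]
    (ρ : Representation k G V) (U : Submodule k V)
    (hU : ∀ g, ∀ u ∈ U, ρ g u ∈ U) : Representation k G U where
  toFun g := (ρ g).restrict (hU g)
  map_one' := by ext; simp
  map_mul' a b := by ext; simp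

lemma subRep_apply {k G V : Type} [Field k] [Group G] [AddCommGroup V] [Module k V]
    (ρ : Representation k G V) (U : Submodule k V)
    (hU : ∀ g, ∀ u ∈ U, ρ g u ∈ U) (g : G) (u : U) :
    ((subRep ρ U hU g u : U) : V) = ρ g u := rfl

noncomputable def subHom {k G : Type} [Field k] [Group G] (V : FDRep k G) (U : Submodule k V)
    (hU : ∀ g, ∀ u ∈ U, V.ρ g u ∈ U) : FDRep.of (subRep V.ρ U hU) ⟶ V :=
  mkHom (V := FDRep.of (subRep V.ρ U hU)) U.subtype (fun _ _ => rfl)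

lemma mono_iff_inj {k G : Type} [Field k] [Group G] {V W : FDRep k G} (f : V ⟶ W) :
    Mono f ↔ Function.Injective (toLin f) := by
  constructor
  · intro hf
    rw [← LinearMap.ker_eq_bot]
    have hU : ∀ g, ∀ u ∈ LinearMap.ker (toLin f), V.ρ g u ∈ LinearMap.ker (toLin f) := by
      intro g u hu
      rw [LinearMap.mem_ker] at hu ⊢
      rw [toLin_comm, hu, map_zero]
    have h0 : subHom V _ hU = 0 := by
      rw [← cancel_mono f]
      apply toLin_inj
      rw [toLin_comp, toLin_comp, toLin_zero, LinearMap.comp_zero]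
      apply LinearMap.ext
      intro u
      exact LinearMap.mem_ker.1 u.2
    rw [eq_bot_iff]
    intro u hu
    have := LinearMap.congr_fun (congrArg toLin h0) ⟨u, hu⟩
    exact this
  · intro hf
    constructor
    intro Z a b hab
    apply toLin_inj
    ext v
    apply hf
    exact LinearMap.congr_fun (congrArg toLin hab) v

lemma simple_iff {k G : Type} [Field k] [Group G] (V : FDRep k G) :
    Simple V ↔ (∃ v : V, v ≠ 0) ∧
      ∀ U : Submodule k V, (∀ g, ∀ u ∈ U, V.ρ g u ∈ U) → U ≠ ⊥ → U = ⊤ := by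
  constructor
  · intro hV
    constructor
    · by_contra! h
      apply id_nonzero V
      apply toLin_inj
      ext v
      rw [toLin_id, toLin_zero]
      exact h v
    · intro U hU hne
      have hm : Mono (subHom V U hU) := by
        rw [mono_iff_inj]
        exact U.injective_subtype
      have hnz : subHom V U hU ≠ 0 := by
        intro h0
        apply hne
        rw [eq_bot_iff]
        intro u hu
        exact LinearMap.congr_fun (congrArg toLin h0) ⟨u, hu⟩
      have := (Simple.mono_isIso_iff_nonzero (subHom V U hU)).2 hnz
      have hb := (bij_of_isIso (subHom V U hU)).2
      rw [eq_top_iff]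
      intro v _
      obtain ⟨u, rfl⟩ := hb v
      exact u.2
  · rintro ⟨⟨v, hv⟩, hU⟩
    constructor
    intro Y f hf
    constructor
    · intro hi h0
      obtain ⟨y, hy⟩ := (bij_of_isIso f).2 v
      rw [h0, toLin_zero] at hy
      exact hv hy.symm
    · intro hne
      apply isIso_of_bij
      refine ⟨(mono_iff_inj f).1 hf, ?_⟩
      rw [← LinearMap.range_eq_top]
      apply hU
      · rintro g _ ⟨y, rfl⟩
        exact ⟨Y.ρ g y, toLin_comm f g y⟩
      · intro h
        apply hne
        apply toLin_inj
        rw [toLin_zero]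
        exact LinearMap.range_eq_bot.1 h

/-- Schur lemma. -/
lemma schur {G : Type} [Group G] (V : FDRep ℂ G) [Simple V] (T : V →ₗ[ℂ] V)
    (hT : ∀ g v, T (V.ρ g v) = V.ρ g (T v)) : ∃ c : ℂ, T = c • LinearMap.id := by
  obtain ⟨⟨v, hv⟩, hU⟩ := (simple_iff V).1 inferInstance
  have : Nontrivial V := ⟨v, 0, hv⟩
  obtain ⟨c, hc⟩ := Module.End.exists_eigenvalue T
  refine ⟨c, ?_⟩
  have := hU (Module.End.eigenspace T c) ?_ hc
  · ext x
    have hx : x ∈ Module.End.eigenspace T c := by rw [this]; trivial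
    simpa using Module.End.mem_eigenspace_iff.1 hx
  · intro g u hu
    rw [Module.End.mem_eigenspace_iff] at hu ⊢
    rw [hT, hu, map_smul]

lemma iso_of_equiv {k G : Type} [Field k] [Group G] {V W : FDRep k G} (e : V ≃ₗ[k] W)
    (he : ∀ g v, e (V.ρ g v) = W.ρ g (e v)) : Nonempty (V ≅ W) := by
  have : IsIso (mkHom (V := V) (W := W) e.toLinearMap he) := by
    apply isIso_of_bij
    rw [toLin_mkHom]
    exact e.bijective
  exact ⟨asIso (mkHom (V := V) (W := W) e.toLinearMap he)⟩

lemma skel_eq {C : Type*} [Category C] {X Y : Skeleton C}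
    (h : Nonempty ((fromSkeleton C).obj X ≅ (fromSkeleton C).obj Y)) : X = Y :=
  skeleton_skeletal C ⟨(fromSkeleton C).preimageIso h.some⟩

noncomputable def sumAct {k G V : Type} [Field k] [Group G] [Fintype G] [AddCommGroup V] [Module k V]
    (ρ : Representation k G V) (w : V) : (G → k) →ₗ[k] V :=
  ∑ g, (LinearMap.toSpanSingleton k V (ρ g w)) ∘ₗ (LinearMap.proj g)

lemma sumAct_apply {k G V : Type} [Field k] [Group G] [Fintype G] [AddCommGroup V] [Module k V]
    (ρ : Representation k G V) (w : V) (c : G → k) : sumAct ρ w c = ∑ g, c g • ρ g w := by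
  simp [sumAct]

lemma sumAct_equiv {k G V : Type} [Field k] [Group G] [Fintype G] [AddCommGroup V] [Module k V]
    (ρ : Representation k G V) (w : V) (c : G → k) (a : G) :
    ρ a (sumAct ρ w c) = sumAct ρ w (fun g => c (a⁻¹ * g)) := by
  rw [sumAct_apply, sumAct_apply, map_sum,
    ← Equiv.sum_comp (Equiv.mulLeft a) (fun g => c (a⁻¹ * g) • ρ g w)]
  simp

lemma sumAct_surj {k G : Type} [Field k] [Group G] [Fintype G] (V : FDRep k G) [Simple V]
    (w : V) (hw : w ≠ 0) : Function.Surjective (sumAct V.ρ w) := by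
  classical
  rw [← LinearMap.range_eq_top]
  apply ((simple_iff V).1 inferInstance).2
  · rintro g _ ⟨c, rfl⟩
    exact ⟨_, (sumAct_equiv _ _ _ _).symm⟩
  · intro h
    apply hw
    have : w ∈ LinearMap.range (sumAct V.ρ w) := by
      refine ⟨Pi.single 1 1, ?_⟩
      rw [sumAct_apply, Finset.sum_eq_single 1] <;> simp +contextual
    rw [h] at this
    exact this

lemma iso_of_ker_eq {k G : Type} [Field k] [Group G] [Fintype G] (V1 V2 : FDRep k G)
    (w1 : V1) (w2 : V2) (s1 : Function.Surjective (sumAct V1.ρ w1))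
    (s2 : Function.Surjective (sumAct V2.ρ w2))
    (h : LinearMap.ker (sumAct V1.ρ w1) = LinearMap.ker (sumAct V2.ρ w2)) : Nonempty (V1 ≅ V2) := by
  let e := ((sumAct V1.ρ w1).quotKerEquivOfSurjective s1).symm.trans
    ((Submodule.quotEquivOfEq _ _ h).trans ((sumAct V2.ρ w2).quotKerEquivOfSurjective s2))
  have he : ∀ c, e (sumAct V1.ρ w1 c) = sumAct V2.ρ w2 c := by
    intro c
    have : ((sumAct V1.ρ w1).quotKerEquivOfSurjective s1).symm (sumAct V1.ρ w1 c)
        = Submodule.Quotient.mk c := by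
      rw [LinearEquiv.symm_apply_eq]; rfl
    simp only [e, LinearEquiv.trans_apply, this]
    rfl
  apply iso_of_equiv e
  intro g v
  obtain ⟨c, rfl⟩ := s1 v
  rw [he, sumAct_equiv, sumAct_equiv, he]

/-- There are finitely many simple representations over a finite field. -/
lemma finite_simples (k G : Type) [Field k] [Finite k] [Group G] [Fintype G] :
    Finite {W : Skeleton (FDRep k G) // Simple ((fromSkeleton (FDRep k G)).obj W)} := by
  have key : ∀ V : FDRep k G, Simple V → ∃ w : V, Function.Surjective (sumAct V.ρ w) := by
    intro V hV
    obtain ⟨w, hw⟩ := ((simple_iff V).1 hV).1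
    exact ⟨w, sumAct_surj V w hw⟩
  have key2 : ∀ V : FDRep k G, ∃ K : Submodule k (G → k), Simple V →
      ∃ w : V, Function.Surjective (sumAct V.ρ w) ∧ LinearMap.ker (sumAct V.ρ w) = K := by
    intro V
    by_cases hV : Simple V
    · obtain ⟨w, hw⟩ := key V hV
      exact ⟨_, fun _ => ⟨w, hw, rfl⟩⟩
    · exact ⟨⊥, fun h => (hV h).elim⟩
  choose K hK using key2
  apply Finite.of_injective (fun W : {W : Skeleton (FDRep k G) //
    Simple ((fromSkeleton (FDRep k G)).obj W)} => K ((fromSkeleton (FDRep k G)).obj W.1))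
  intro W1 W2 h
  obtain ⟨w1, s1, h1⟩ := hK _ W1.2
  obtain ⟨w2, s2, h2⟩ := hK _ W2.2
  apply Subtype.ext
  apply skel_eq
  exact iso_of_ker_eq _ _ w1 w2 s1 s2 (h1.trans (h.trans h2.symm))

end PSp

namespace PSp

structure CharData {Q R : Type} [Group Q] [Fintype Q] [CommRing R] (χ : Q → R) (ω d : ℕ) : Prop where
  comm : ∀ a b, χ (a * b) = χ (b * a)
  conv : ∀ a b, ∑ x : Q, χ (a * (x * b * x⁻¹)) = ω * χ a * χ b
  sq : ∀ g, ∑ h : Q, χ h⁻¹ * χ (h * g) = ω * χ g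
  one : χ 1 = d
  card : ω * d = Fintype.card Q

lemma CharData.map {Q R S : Type} [Group Q] [Fintype Q] [CommRing R] [CommRing S] {χ : Q → R}
    {ω d : ℕ} (h : CharData χ ω d) (f : R →+* S) : CharData (fun q => f (χ q)) ω d where
  comm a b := by rw [h.comm]
  conv a b := by rw [← map_sum, h.conv]; simp
  sq g := by simp_rw [← map_mul, ← map_sum, h.sq]; simp
  one := by rw [h.one]; simp
  card := h.card

lemma CharData.of_map {Q R S : Type} [Group Q] [Fintype Q] [CommRing R] [CommRing S] {χ : Q → R}
    {ω d : ℕ} (f : R →+* S) (hf : Function.Injective f) (h : CharData (fun q => f (χ q)) ω d) :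
    CharData χ ω d where
  comm a b := hf (h.comm a b)
  conv a b := hf (by have := h.conv a b; simpa using this)
  sq g := hf (by have := h.sq g; simpa using this)
  one := hf (by have := h.one; simpa using this)
  card := h.card

lemma CharData.pos {Q R : Type} [Group Q] [Fintype Q] [CommRing R] {χ : Q → R}
    {ω d : ℕ} (h : CharData χ ω d) : ω ≠ 0 ∧ d ≠ 0 := by
  have : ω * d ≠ 0 := by rw [h.card]; exact Fintype.card_ne_zero
  exact ⟨left_ne_zero_of_mul this, right_ne_zero_of_mul this⟩

/-- orthogonality -/
lemma CharData.orth {Q R : Type} [Group Q] [Fintype Q] [Field R] [CharZero R] {f₁ f₂ : Q → R}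
    {ω₁ d₁ ω₂ d₂ : ℕ} (h₁ : CharData f₁ ω₁ d₁) (h₂ : CharData f₂ ω₂ d₂) (a : Q)
    (hT : ∑ h, f₁ h⁻¹ * f₂ (h * a) ≠ 0) : f₁ = f₂ := by
  have key : ∀ b, (ω₂ : R) * f₂ b = ω₁ * f₁ b := by
    intro b
    apply mul_right_cancel₀ hT
    have e1 : ∑ x : Q, ∑ h : Q, f₁ h⁻¹ * f₂ (h * (a * (x * b * x⁻¹))) =
        ω₂ * f₂ b * ∑ h, f₁ h⁻¹ * f₂ (h * a) := by
      rw [Finset.sum_comm, Finset.mul_sum]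
      refine Finset.sum_congr rfl fun h _ => ?_
      rw [← Finset.mul_sum]
      simp_rw [← mul_assoc h a]
      rw [h₂.conv]; ring
    have e2 : ∑ x : Q, ∑ h : Q, f₁ h⁻¹ * f₂ (h * (a * (x * b * x⁻¹))) =
        ω₁ * f₁ b * ∑ h, f₁ h⁻¹ * f₂ (h * a) := by
      have shift : ∀ c : Q, ∑ h, f₁ h⁻¹ * f₂ (h * c) = ∑ h, f₁ (h⁻¹ * c) * f₂ h := by
        intro c
        rw [← Equiv.sum_comp (Equiv.mulRight c) (fun h => f₁ (h⁻¹ * c) * f₂ h)]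
        refine Finset.sum_congr rfl fun h _ => ?_
        rw [h₁.comm]
        simp
      simp_rw [shift]
      rw [Finset.sum_comm, Finset.mul_sum]
      refine Finset.sum_congr rfl fun h _ => ?_
      rw [← Finset.sum_mul]
      simp_rw [← mul_assoc h⁻¹ a]
      rw [h₁.conv]; ring
    rw [← e1, e2]
  have hQ : (Fintype.card Q : R) ≠ 0 := Nat.cast_ne_zero.2 Fintype.card_ne_zero
  have s1 : ∑ h : Q, f₁ h⁻¹ * f₁ h = Fintype.card Q := by
    have := h₁.sq 1
    simp only [mul_one] at this
    rw [this, h₁.one, ← h₁.card]; push_cast; ring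
  have s2 : ∑ h : Q, f₂ h⁻¹ * f₂ h = Fintype.card Q := by
    have := h₂.sq 1
    simp only [mul_one] at this
    rw [this, h₂.one, ← h₂.card]; push_cast; ring
  have hsq : (ω₁ : R) ^ 2 * Fintype.card Q = ω₂ ^ 2 * Fintype.card Q := by
    rw [← s1]
    nth_rewrite 2 [s1]
    rw [← s2, Finset.mul_sum, Finset.mul_sum]
    refine Finset.sum_congr rfl fun h _ => ?_
    linear_combination (-(ω₂ : R) * f₂ h) * key h⁻¹ - (ω₁ * f₁ h⁻¹) * key h
  have hω : ω₁ = ω₂ := by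
    have := mul_right_cancel₀ hQ hsq
    have h3 : ω₁ ^ 2 = ω₂ ^ 2 := by exact_mod_cast this
    exact Nat.pow_left_injective two_ne_zero h3
  subst hω
  funext b
  exact (mul_left_cancel₀ (Nat.cast_ne_zero.2 h₁.pos.1) (key b)).symm

lemma nat_notMem {O : Type} [CommRing O] (P : Ideal O) [hP : P.IsPrime] {p ω : ℕ} (hp : p.Prime)
    (hpP : (p : O) ∈ P) (hω : ¬ p ∣ ω) : (ω : O) ∉ P := by
  intro h
  have hc : IsCoprime (p : ℤ) (ω : ℤ) := Nat.isCoprime_iff_coprime.2 ((Nat.Prime.coprime_iff_not_dvd hp).2 hω)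
  obtain ⟨a, b, hab⟩ := hc
  apply hP.ne_top
  rw [Ideal.eq_top_iff_one]
  have : (1 : O) = (a : O) * (p : O) + (b : O) * (ω : O) := by
    have := congrArg (Int.cast : ℤ → O) hab
    push_cast at this
    exact this.symm
  rw [this]
  exact P.add_mem (P.mul_mem_left _ hpP) (P.mul_mem_left _ h)

lemma CharData.exists_notMem {Q O : Type} [Group Q] [Fintype Q] [CommRing O] [IsDomain O]
    [IsNoetherianRing O] [CharZero O] {χ : Q → O} {ω d : ℕ} (h : CharData χ ω d) (P : Ideal O)
    [hP : P.IsPrime] {p : ℕ} (hp : p.Prime) (hpP : (p : O) ∈ P) (hω : ¬ p ∣ ω) :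
    ∃ g, χ g ∉ P := by
  by_contra! hall
  have key : ∀ m : ℕ, ∀ g, χ g ∈ P ^ (m + 1) := by
    intro m
    induction m with
    | zero => intro g; simpa using hall g
    | succ m ih =>
      intro g
      have h1 : (ω : O) * χ g ∈ P ^ (m + 1 + 1) := by
        rw [← h.sq]
        refine Ideal.sum_mem _ fun x _ => ?_
        rw [pow_succ]
        exact Ideal.mul_mem_mul (ih _) (hall _)
      have hc : IsCoprime ((p : ℤ) ^ (m + 1 + 1)) (ω : ℤ) :=
        (Nat.isCoprime_iff_coprime.2 ((Nat.Prime.coprime_iff_not_dvd hp).2 hω)).pow_left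
      obtain ⟨a, b, hab⟩ := hc
      have h2 : χ g = ((a : O) * χ g) * (p : O) ^ (m + 1 + 1) + (b : O) * ((ω : O) * χ g) := by
        have := congrArg (Int.cast : ℤ → O) hab
        push_cast at this
        linear_combination (-χ g) * this
      rw [h2]
      exact Ideal.add_mem _ (Ideal.mul_mem_left _ _ (Ideal.pow_mem_pow hpP _))
        (Ideal.mul_mem_left _ _ h1)
  have hd : (d : O) ∈ (⨅ i : ℕ, P ^ i : Ideal O) := by
    rw [Ideal.mem_iInf, ← h.one]
    intro i
    exact Ideal.pow_le_pow_right (Nat.le_succ i) (key i 1)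
  rw [Ideal.iInf_pow_eq_bot_of_isDomain P hP.ne_top] at hd
  exact h.pos.2 (Nat.cast_eq_zero.1 (Ideal.mem_bot.1 hd))

/-- Sum over a group of a function right invariant under a subgroup. -/
lemma sum_quot {G M : Type} [Group G] [Fintype G] [AddCommMonoid M] (N : Subgroup G)
    [Fintype (G ⧸ N)] (f : G → M) (hf : ∀ g, ∀ n ∈ N, f (g * n) = f g) :
    ∑ g, f g = Nat.card N • ∑ q : G ⧸ N, f q.out := by
  classical
  have : Fintype N := Fintype.ofFinite _
  have hb : Function.Bijective (fun y : (G ⧸ N) × N => y.1.out * (y.2 : G)) := by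
    constructor
    · rintro ⟨q, n⟩ ⟨q', n'⟩ h
      simp only at h
      have hq : q = q' := by
        have h2 := congrArg (QuotientGroup.mk : G → G ⧸ N) h
        rw [QuotientGroup.mk_mul_of_mem _ n.2, QuotientGroup.mk_mul_of_mem _ n'.2,
          QuotientGroup.out_eq', QuotientGroup.out_eq'] at h2
        exact h2
      subst hq
      have := mul_left_cancel h
      exact Prod.ext rfl (Subtype.ext this)
    · intro g
      have h2 : (QuotientGroup.mk g : G ⧸ N).out⁻¹ * g ∈ N := by
        rw [← QuotientGroup.eq, QuotientGroup.out_eq']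
      exact ⟨(QuotientGroup.mk g, ⟨_, h2⟩), mul_inv_cancel_left _ _⟩
  rw [← Equiv.sum_comp (Equiv.ofBijective _ hb) f, Fintype.sum_prod_type, Finset.smul_sum]
  refine Finset.sum_congr rfl fun q _ => ?_
  have : ∀ y : N, f (Equiv.ofBijective _ hb (q, y)) = f q.out := fun y => hf _ _ y.2
  simp_rw [this]
  simp

lemma kernel_trivial {Q k : Type} [Group Q] [Fintype Q] [Field k]
    (χ : Q → k) (ω : ℕ) (hω : (ω : k) ≠ 0) (g₀ : Q) (hg₀ : χ g₀ ≠ 0)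
    (w : Q → k) (hw : w ≠ 0) (hc : ∀ x g, ∑ h : Q, w (x * (h * g * h⁻¹)) = ω * χ g * w x)
    (K : Subgroup Q) [Fintype K] [hN : K.Normal] (hK : ∀ x, ∀ n ∈ K, w (x * n) = w x)
    (hχ : K ≠ ⊥ → ∀ g, ∑ n : K, χ (n * g) = 0) : K = ⊥ := by
  classical
  by_contra hne
  obtain ⟨x, hx⟩ : ∃ x, w x ≠ 0 := by
    by_contra! h
    exact hw (funext h)
  have hne0 : (ω : k) * χ g₀ * w x ≠ 0 := mul_ne_zero (mul_ne_zero hω hg₀) hx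
  -- step 2
  have h2 : (Nat.card K : k) = 0 := by
    have e : ∑ n : K, ∑ h : Q, w (x * (h * (n * g₀) * h⁻¹)) = 0 := by
      simp_rw [hc]
      rw [← Finset.sum_mul, ← Finset.mul_sum, hχ hne, mul_zero, zero_mul]
    have e' : ∀ n : K, ∑ h : Q, w (x * (h * (n * g₀) * h⁻¹)) = ω * χ g₀ * w x := by
      intro n
      rw [← hc]
      refine Finset.sum_congr rfl fun h _ => ?_
      have hm : (h * g₀⁻¹) * n * (h * g₀⁻¹)⁻¹ ∈ K := hN.conj_mem _ n.2 _
      have : (h * g₀ * h⁻¹)⁻¹ * (h * n * g₀ * h⁻¹) ∈ K := by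
        convert hm using 1; group
      rw [← hK (x * (h * g₀ * h⁻¹)) _ this]
      congr 1; group
    simp_rw [e'] at e
    simp only [Finset.sum_const, Finset.card_univ, nsmul_eq_mul] at e
    rw [Nat.card_eq_fintype_card]
    exact (mul_eq_zero.1 e).resolve_right hne0
  apply hne0
  rw [← hc, sum_quot K (fun h => w (x * (h * g₀ * h⁻¹))), nsmul_eq_mul, h2, zero_mul]
  intro g n hn
  have h1 : (g * n * g⁻¹) ∈ K := hN.conj_mem _ hn _
  have h3 : (g * g₀ * g⁻¹)⁻¹ * (g * n * g⁻¹) * (g * g₀ * g⁻¹) * (g * n * g⁻¹)⁻¹ ∈ K := by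
    apply K.mul_mem _ (K.inv_mem h1)
    have := hN.conj_mem _ h1 (g * g₀ * g⁻¹)⁻¹
    simpa using this
  rw [← hK (x * (g * g₀ * g⁻¹)) _ h3]
  congr 1; group

end PSp

namespace PSp

lemma char_integral {G : Type} [Group G] [Fintype G] (V : FDRep ℂ G) (g : G) :
    IsIntegral ℤ (V.character g) := by
  have h1 : V.character g = (V.ρ g).charpoly.roots.sum :=
    Module.End.trace_eq_sum_roots_charpoly_of_splits (IsAlgClosed.splits _)
  rw [h1]
  apply IsIntegral.multiset_sum
  intro μ hμ
  have hev : Module.End.HasEigenvalue (V.ρ g) μ := by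
    rw [Module.End.hasEigenvalue_iff_isRoot_charpoly]
    exact (Polynomial.mem_roots'.1 hμ).2
  obtain ⟨v, hv⟩ := hev.exists_hasEigenvector
  have hp := hv.pow_apply (Fintype.card G)
  rw [← map_pow, pow_card_eq_one, map_one] at hp
  have h2 : μ ^ Fintype.card G = 1 := by
    have h3 : (μ ^ Fintype.card G - 1) • v = 0 := by
      rw [sub_smul, ← hp]; simp
    exact sub_eq_zero.1 ((smul_eq_zero.1 h3).resolve_right hv.2)
  apply IsIntegral.of_pow (n := Fintype.card G) Fintype.card_pos
  rw [h2]
  exact isIntegral_one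

lemma mem_repKer {G : Type} [Group G] (V : FDRep ℂ G) (g : G) : g ∈ V.repKer ↔ V.ρ g = 1 := Iff.rfl

noncomputable def rhoQ {G : Type} [Group G] (V : FDRep ℂ G) :
    (G ⧸ V.repKer) →* (V →ₗ[ℂ] V) :=
  QuotientGroup.lift V.repKer V.ρ (fun _ h => h)

lemma rhoQ_mk {G : Type} [Group G] (V : FDRep ℂ G) (g : G) :
    rhoQ V (QuotientGroup.mk g) = V.ρ g := rfl

lemma rhoQ_out {G : Type} [Group G] (V : FDRep ℂ G) (q : G ⧸ V.repKer) :
    rhoQ V q = V.ρ q.out := by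
  rw [← rhoQ_mk, QuotientGroup.out_eq']

lemma schurQ {G : Type} [Group G] (V : FDRep ℂ G) [Simple V] (T : V →ₗ[ℂ] V)
    (hT : ∀ q, T * rhoQ V q = rhoQ V q * T) : ∃ c : ℂ, T = c • 1 :=
  schur V T fun g v => LinearMap.congr_fun (hT (QuotientGroup.mk g)) v

lemma finrank_ne_zero {G : Type} [Group G] (V : FDRep ℂ G) [Simple V] :
    Module.finrank ℂ V ≠ 0 := by
  obtain ⟨⟨v, hv⟩, -⟩ := (simple_iff V).1 inferInstance
  have : Nontrivial V := ⟨v, 0, hv⟩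
  exact Module.finrank_pos.ne'

lemma conj_sum {G : Type} [Group G] [Fintype G] (V : FDRep ℂ G) [Simple V]
    [Fintype (G ⧸ V.repKer)] (b : G ⧸ V.repKer) :
    ∑ x, rhoQ V (x * b * x⁻¹) =
      ((Fintype.card (G ⧸ V.repKer) : ℂ) / Module.finrank ℂ V *
        LinearMap.trace ℂ V (rhoQ V b)) • 1 := by
  obtain ⟨c, hc⟩ := schurQ V (∑ x, rhoQ V (x * b * x⁻¹)) (by
    intro q
    rw [Finset.sum_mul, Finset.mul_sum,
      ← Equiv.sum_comp (Equiv.mulLeft q) (fun x => rhoQ V (x * b * x⁻¹) * rhoQ V q)]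
    refine Finset.sum_congr rfl fun x _ => ?_
    rw [← map_mul, ← map_mul]
    congr 1
    simp only [Equiv.coe_mulLeft]
    group)
  have ht := congrArg (LinearMap.trace ℂ V) hc
  have hd : (Module.finrank ℂ V : ℂ) ≠ 0 := Nat.cast_ne_zero.2 (finrank_ne_zero V)
  have : ∀ x, LinearMap.trace ℂ V (rhoQ V (x * b * x⁻¹)) = LinearMap.trace ℂ V (rhoQ V b) := by
    intro x
    rw [mul_assoc, map_mul, LinearMap.trace_mul_comm, ← map_mul, inv_mul_cancel_right]
  rw [map_sum] at ht
  simp_rw [this] at ht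
  rw [map_smul, LinearMap.trace_one] at ht
  simp only [Finset.sum_const, Finset.card_univ, nsmul_eq_mul, smul_eq_mul] at ht
  rw [hc]
  congr 1
  field_simp
  rw [ht, mul_comm]

lemma char_norm {G : Type} [Group G] [Fintype G] (V : FDRep ℂ G) [Simple V]
    [Fintype (G ⧸ V.repKer)] :
    ∑ x, LinearMap.trace ℂ V (rhoQ V x⁻¹) * LinearMap.trace ℂ V (rhoQ V x) =
      (Fintype.card (G ⧸ V.repKer) : ℂ) := by
  classical
  have hG : (Nat.card G : ℂ) ≠ 0 := Nat.cast_ne_zero.2 Nat.card_pos.ne'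
  have : Invertible (Nat.card G : ℂ) := invertibleOfNonzero hG
  have h := FDRep.char_orthonormal V V
  rw [if_pos ⟨Iso.refl V⟩] at h
  have h1 : ∑ g : G, V.character g⁻¹ * V.character g = Nat.card G := by
    field_simp at h
    rw [← h]
    exact Finset.sum_congr rfl fun g _ => mul_comm _ _
  have hN : (Nat.card V.repKer : ℂ) ≠ 0 := Nat.cast_ne_zero.2 Nat.card_pos.ne'
  rw [sum_quot V.repKer] at h1
  · rw [← V.repKer.card_mul_index, Subgroup.index, nsmul_eq_mul] at h1
    push_cast at h1
    have h2 := mul_left_cancel₀ hN h1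
    rw [← Nat.card_eq_fintype_card, ← h2]
    refine Finset.sum_congr rfl fun q _ => ?_
    rw [FDRep.character, FDRep.character, ← rhoQ_mk, ← rhoQ_mk, QuotientGroup.mk_inv,
      QuotientGroup.out_eq']
  · intro g n hn
    have h3 : V.ρ n = 1 := hn
    have h4 : V.ρ n⁻¹ = 1 := V.repKer.inv_mem hn
    simp only [FDRep.character, mul_inv_rev, map_mul, h3, h4, one_mul, mul_one]

lemma charData_aux {G : Type} [Group G] [Fintype G] (V : FDRep ℂ G) [Simple V]
    [Fintype (G ⧸ V.repKer)] (χ : G ⧸ V.repKer → ℂ)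
    (hχ : ∀ q, χ q = LinearMap.trace ℂ V (rhoQ V q)) :
    (∀ a b, χ (a * b) = χ (b * a)) ∧
    (∀ a b, ∑ x, χ (a * (x * b * x⁻¹)) =
      (Fintype.card (G ⧸ V.repKer) : ℂ) / Module.finrank ℂ V * χ a * χ b) ∧
    (∀ g, ∑ h, χ h⁻¹ * χ (h * g) =
      (Fintype.card (G ⧸ V.repKer) : ℂ) / Module.finrank ℂ V * χ g) ∧
    χ 1 = Module.finrank ℂ V := by
  have hcomm : ∀ a b, χ (a * b) = χ (b * a) := by
    intro a b
    rw [hχ, hχ, map_mul, LinearMap.trace_mul_comm, ← map_mul]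
  have hconv : ∀ a b, ∑ x, χ (a * (x * b * x⁻¹)) =
      (Fintype.card (G ⧸ V.repKer) : ℂ) / Module.finrank ℂ V * χ a * χ b := by
    intro a b
    simp_rw [hχ, map_mul (rhoQ V) a]
    rw [← map_sum, ← Finset.mul_sum, conj_sum, mul_smul_comm, mul_one, map_smul, smul_eq_mul]
    ring
  refine ⟨hcomm, hconv, ?_, by rw [hχ, map_one, LinearMap.trace_one]⟩
  intro b
  have hQ : (Fintype.card (G ⧸ V.repKer) : ℂ) ≠ 0 := Nat.cast_ne_zero.2 Fintype.card_ne_zero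
  have hn := char_norm V
  simp_rw [← hχ] at hn
  apply mul_left_cancel₀ hQ
  have e1 : ∑ x, ∑ h, χ h⁻¹ * χ (h * (x * b * x⁻¹)) =
      (Fintype.card (G ⧸ V.repKer) : ℂ) * ∑ h, χ h⁻¹ * χ (h * b) := by
    have : ∀ x, ∑ h, χ h⁻¹ * χ (h * (x * b * x⁻¹)) = ∑ h, χ h⁻¹ * χ (h * b) := by
      intro x
      rw [← Equiv.sum_comp (MulAut.conj x).toEquiv (fun h => χ h⁻¹ * χ (h * (x * b * x⁻¹)))]
      refine Finset.sum_congr rfl fun h _ => ?_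
      simp only [MulEquiv.toEquiv_eq_coe, MulEquiv.coe_toEquiv, MulAut.conj_apply]
      rw [show (x * h * x⁻¹)⁻¹ = x * (h⁻¹ * x⁻¹) by group, hcomm x,
        show x * h * x⁻¹ * (x * b * x⁻¹) = x * (h * b * x⁻¹) by group, hcomm x]
      simp
    simp_rw [this]
    simp
  rw [← e1, Finset.sum_comm]
  simp_rw [← Finset.mul_sum, hconv]
  rw [← hn, Finset.sum_mul]
  refine Finset.sum_congr rfl fun h _ => ?_
  rw [hn]
  ring

lemma rat_integral_nat {a d : ℕ} (hd : d ≠ 0) (h : IsIntegral ℤ ((a : ℂ) / d)) : d ∣ a := by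
  have h1 : IsIntegral ℤ ((a : ℚ) / d) := by
    rw [← isIntegral_algebraMap_iff (B := ℂ) (algebraMap ℚ ℂ).injective]
    simpa using h
  obtain ⟨z, hz⟩ := IsIntegrallyClosed.isIntegral_iff.1 h1
  have hd' : (d : ℚ) ≠ 0 := Nat.cast_ne_zero.2 hd
  have : (d : ℤ) * z = a := by
    have : (d : ℚ) * z = a := by
      rw [show (z : ℚ) = algebraMap ℤ ℚ z from rfl, hz]; field_simp
    exact_mod_cast this
  exact Int.natCast_dvd_natCast.1 ⟨z, this.symm⟩

lemma dim_dvd {G : Type} [Group G] [Fintype G] (V : FDRep ℂ G) [Simple V]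
    [Fintype (G ⧸ V.repKer)] : Module.finrank ℂ V ∣ Fintype.card (G ⧸ V.repKer) := by
  have hd : Module.finrank ℂ V ≠ 0 := finrank_ne_zero V
  apply rat_integral_nat hd
  set χ : G ⧸ V.repKer → ℂ := fun q => LinearMap.trace ℂ V (rhoQ V q) with hχ
  obtain ⟨-, -, h, h1⟩ := charData_aux V χ (fun _ => rfl)
  set r := (Fintype.card (G ⧸ V.repKer) : ℂ) / Module.finrank ℂ V
  have hintegral : ∀ q, IsIntegral ℤ (χ q) := by
    intro q
    simp only [hχ, rhoQ_out]
    exact char_integral V q.out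
  let A := integralClosure ℤ ℂ
  let M : Submodule A ℂ := Submodule.span A (Set.range χ)
  have hr : IsIntegral A r := by
    apply isIntegral_of_smul_mem_submodule (M := ℂ) (N := M)
    · intro hM
      have : χ 1 ∈ M := Submodule.subset_span ⟨1, rfl⟩
      rw [hM, Submodule.mem_bot, h1] at this
      exact hd (Nat.cast_eq_zero.1 this)
    · exact Submodule.fg_span (Set.finite_range χ)
    · intro n hn
      induction hn using Submodule.span_induction with
      | mem x hx =>
        obtain ⟨g, rfl⟩ := hx
        rw [smul_eq_mul, ← h]
        refine M.sum_mem fun x _ => ?_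
        exact M.smul_mem (⟨χ x⁻¹, hintegral _⟩ : A) (Submodule.subset_span ⟨x * g, rfl⟩)
      | zero => simp
      | add x y _ _ hx hy => rw [smul_add]; exact M.add_mem hx hy
      | smul a x _ hx => rw [smul_comm]; exact M.smul_mem a hx
  exact isIntegral_trans (A := A) r hr

lemma charData {G : Type} [Group G] [Fintype G] (V : FDRep ℂ G) [Simple V]
    [Fintype (G ⧸ V.repKer)] :
    CharData (fun q : G ⧸ V.repKer => V.character q.out) V.omega (Module.finrank ℂ V) := by
  have hd : Module.finrank ℂ V ≠ 0 := finrank_ne_zero V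
  obtain ⟨m, hm⟩ := dim_dvd V
  have hω : V.omega = m := by
    have h1 := V.repKer.card_mul_index
    rw [Subgroup.index, Nat.card_eq_fintype_card (α := G ⧸ _), Nat.card_eq_fintype_card (α := G), hm] at h1
    rw [FDRep.omega, ← h1, ← mul_assoc]
    exact Nat.mul_div_cancel_left _ (Nat.mul_pos Nat.card_pos (Nat.pos_of_ne_zero hd))
  have hr : (Fintype.card (G ⧸ V.repKer) : ℂ) / Module.finrank ℂ V = V.omega := by
    have hd' : (Module.finrank ℂ V : ℂ) ≠ 0 := Nat.cast_ne_zero.2 hd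
    rw [hω, hm]; push_cast; field_simp
  obtain ⟨h1, h2, h3, h4⟩ := charData_aux V (fun q : G ⧸ V.repKer => V.character q.out)
    (fun q => by rw [rhoQ_out]; rfl)
  rw [hr] at h2 h3
  exact ⟨h1, h2, h3, h4, by rw [hω, hm, mul_comm]⟩

/-- sums over nontrivial normal subgroups vanish -/
lemma char_normal_sum {G : Type} [Group G] [Fintype G] (V : FDRep ℂ G) [Simple V]
    (K : Subgroup (G ⧸ V.repKer)) [hN : K.Normal] [Fintype K] (hK : K ≠ ⊥) (g : G ⧸ V.repKer) :
    ∑ n : K, V.character ((n : G ⧸ V.repKer) * g).out = 0 := by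
  obtain ⟨c, hc⟩ := schurQ V (∑ n : K, rhoQ V n) (by
    intro q
    rw [Finset.sum_mul, Finset.mul_sum,
      ← Equiv.sum_comp (MulAut.conjNormal (H := K) q).toEquiv (fun x : K => rhoQ V x * rhoQ V q)]
    refine Finset.sum_congr rfl fun x _ => ?_
    rw [← map_mul, ← map_mul]
    congr 1
    simp)
  have h0 : c = 0 := by
    by_contra hc0
    apply hK
    rw [eq_bot_iff]
    intro n hn
    have h1 : rhoQ V n * (∑ n : K, rhoQ V n) = ∑ n : K, rhoQ V n := by
      rw [Finset.mul_sum, ← Equiv.sum_comp (Equiv.mulLeft (⟨n, hn⟩ : K)) (fun x : K => rhoQ V x)]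
      refine Finset.sum_congr rfl fun x _ => ?_
      rw [← map_mul]; rfl
    rw [hc, mul_smul_comm, mul_one] at h1
    have h2 : rhoQ V n = 1 := smul_right_injective _ hc0 h1
    rw [rhoQ_out] at h2
    have h3 : n.out ∈ V.repKer := h2
    rw [Subgroup.mem_bot, ← QuotientGroup.out_eq' n]
    exact (QuotientGroup.eq_one_iff _).2 h3
  have : ∀ n : K, V.character ((n : G ⧸ V.repKer) * g).out =
      LinearMap.trace ℂ V (rhoQ V n * rhoQ V g) := by
    intro n
    rw [← map_mul, rhoQ_out]; rfl
  simp_rw [this]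
  rw [← map_sum, ← Finset.sum_mul, hc, h0]
  simp

lemma char_out {G : Type} [Group G] (V : FDRep ℂ G) (g : G) :
    V.character (QuotientGroup.mk g : G ⧸ V.repKer).out = V.character g := by
  rw [FDRep.character, ← rhoQ_out]; rfl

lemma iso_of_char_eq {G : Type} [Group G] [Fintype G] (V W : FDRep ℂ G) [Simple V] [Simple W]
    (h : V.character = W.character) : Nonempty (V ≅ W) := by
  classical
  have hG : (Nat.card G : ℂ) ≠ 0 := Nat.cast_ne_zero.2 Nat.card_pos.ne'
  have : Invertible (Nat.card G : ℂ) := invertibleOfNonzero hG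
  have h1 := FDRep.char_orthonormal V W
  have h2 := FDRep.char_orthonormal V V
  rw [if_pos ⟨Iso.refl V⟩] at h2
  rw [← h, h2] at h1
  by_contra hne
  rw [if_neg hne] at h1
  exact one_ne_zero h1

end PSp

namespace PSp

lemma trace_int (E : IntermediateField ℚ ℂ) [FiniteDimensional ℚ E] (a : integralClosure ℤ E) :
    ∃ n : ℤ, (n : ℂ) = ∑ σ : E →ₐ[ℚ] ℂ, σ (a : E) := by
  have h : IsIntegral ℤ (Algebra.trace ℚ E (a : E)) := Algebra.isIntegral_trace a.2
  obtain ⟨n, hn⟩ := IsIntegrallyClosed.isIntegral_iff.1 h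
  refine ⟨n, ?_⟩
  rw [← trace_eq_sum_embeddings ℂ (K := ℚ) (L := E), ← hn]
  simp

lemma exists_coeff {Q : Type} [Group Q] [Fintype Q] (E : IntermediateField ℚ ℂ)
    [FiniteDimensional ℚ E] (χ : Q → integralClosure ℤ E) (a : integralClosure ℤ E) (g₀ : Q) :
    ∃ n : Q → ℤ, ∀ ψ : Q → ℂ, ∑ q, (n q : ℂ) * ψ q =
      ∑ σ : E →ₐ[ℚ] ℂ, σ (a : E) * ∑ h, σ (χ h⁻¹ : E) * ψ (h * g₀) := by
  choose t ht using trace_int E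
  refine ⟨fun q => t (a * χ (q * g₀⁻¹)⁻¹), fun ψ => ?_⟩
  rw [← Equiv.sum_comp (Equiv.mulRight g₀)]
  simp_rw [Finset.mul_sum]
  rw [Finset.sum_comm]
  refine Finset.sum_congr rfl fun h _ => ?_
  rw [ht, Finset.sum_mul]
  refine Finset.sum_congr rfl fun σ _ => ?_
  simp [mul_assoc]

/-- the ring hom from the integers to `ℂ` induced by an embedding -/
noncomputable def embO (E : IntermediateField ℚ ℂ) (σ : E →ₐ[ℚ] ℂ) : integralClosure ℤ E →+* ℂ :=
  (σ : E →+* ℂ).comp (algebraMap (integralClosure ℤ E) E)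

lemma embO_apply (E : IntermediateField ℚ ℂ) (σ : E →ₐ[ℚ] ℂ) (a : integralClosure ℤ E) :
    embO E σ a = σ (a : E) := rfl

lemma embO_inj (E : IntermediateField ℚ ℂ) (σ : E →ₐ[ℚ] ℂ) : Function.Injective (embO E σ) := by
  intro a b h
  rw [embO_apply, embO_apply] at h
  exact Subtype.ext (σ.injective h)

lemma coeff_self {Q : Type} [Group Q] [Fintype Q] (E : IntermediateField ℚ ℂ)
    [FiniteDimensional ℚ E] (χ : Q → integralClosure ℤ E) {ω d : ℕ} (hχ : CharData χ ω d)
    (hgen : ∀ σ : E →ₐ[ℚ] ℂ, (∀ q, σ (χ q : E) = ((χ q : E) : ℂ)) → σ = E.val)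
    (a : integralClosure ℤ E) (g₀ : Q) (n : Q → ℤ)
    (hn : ∀ ψ : Q → ℂ, ∑ q, (n q : ℂ) * ψ q =
      ∑ σ : E →ₐ[ℚ] ℂ, σ (a : E) * ∑ h, σ (χ h⁻¹ : E) * ψ (h * g₀)) :
    ∑ q, (n q : integralClosure ℤ E) * χ q = a * (ω * χ g₀) := by
  apply embO_inj E E.val
  have h1 := hn (fun q => embO E E.val (χ q))
  have h3 : ∑ σ : E →ₐ[ℚ] ℂ, σ (a : E) * ∑ h, σ (χ h⁻¹ : E) * embO E E.val (χ (h * g₀)) =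
      embO E E.val a * ∑ h, embO E E.val (χ h⁻¹) * embO E E.val (χ (h * g₀)) := by
    refine Finset.sum_eq_single (E.val : E →ₐ[ℚ] ℂ) ?_ ?_
    · intro σ _ hσ
      by_contra hne
      apply hσ
      apply hgen
      have := (hχ.map (embO E σ)).orth (hχ.map (embO E E.val)) g₀ (right_ne_zero_of_mul hne)
      exact fun q => congrFun this q
    · intro h
      exact absurd (Finset.mem_univ _) h
  have h2 := (hχ.map (embO E E.val)).sq g₀
  rw [h3] at h1
  rw [map_sum]
  simp only [map_mul, map_intCast, map_natCast]
  rw [h1]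
  congr 1

lemma conj_of_cong {Q : Type} [Group Q] [Fintype Q] (E F : IntermediateField ℚ ℂ)
    [FiniteDimensional ℚ E] (χ : Q → integralClosure ℤ E)
    {ω d : ℕ} (hχ : CharData χ ω d)
    (hgen : ∀ σ : E →ₐ[ℚ] ℂ, (∀ q, σ (χ q : E) = ((χ q : E) : ℂ)) → σ = E.val)
    (ψ : Q → integralClosure ℤ F) {ω' d' : ℕ} (hψ : CharData ψ ω' d')
    (P : Ideal (integralClosure ℤ E)) [hP : P.IsPrime] (P' : Ideal (integralClosure ℤ F))
    (hω : (ω : integralClosure ℤ E) ∉ P) (g₀ : Q) (hg₀ : χ g₀ ∉ P)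
    (H : ∀ n : Q → ℤ, ∑ q, (n q : integralClosure ℤ F) * ψ q ∈ P' →
      ∑ q, (n q : integralClosure ℤ E) * χ q ∈ P) :
    ∃ σ : E →ₐ[ℚ] ℂ, ∀ q, σ (χ q : E) = ((ψ q : F) : ℂ) := by
  obtain ⟨n, hn⟩ := exists_coeff E χ 1 g₀
  by_contra! hcon
  have h1 := coeff_self E χ hχ hgen 1 g₀ n hn
  have h0 : ∑ q, (n q : integralClosure ℤ F) * ψ q = 0 := by
    apply embO_inj F F.val
    rw [map_sum]
    simp only [map_mul, map_intCast, map_zero]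
    rw [hn]
    refine Finset.sum_eq_zero fun σ _ => ?_
    by_contra hne
    have := (hχ.map (embO E σ)).orth (hψ.map (embO F F.val)) g₀ (right_ne_zero_of_mul hne)
    obtain ⟨q, hq⟩ := hcon σ
    exact hq (congrFun this q)
  have h2 := H n (by rw [h0]; exact P'.zero_mem)
  rw [h1, one_mul] at h2
  exact (hP.mem_or_mem h2).elim hω hg₀

lemma ideal_le_of_cong {Q : Type} [Group Q] [Fintype Q] (E : IntermediateField ℚ ℂ)
    [FiniteDimensional ℚ E] (χ : Q → integralClosure ℤ E)
    {ω d : ℕ} (hχ : CharData χ ω d)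
    (hgen : ∀ σ : E →ₐ[ℚ] ℂ, (∀ q, σ (χ q : E) = ((χ q : E) : ℂ)) → σ = E.val)
    (P : Ideal (integralClosure ℤ E)) [hP : P.IsPrime] (P' : Ideal (integralClosure ℤ E))
    (hω : (ω : integralClosure ℤ E) ∉ P) (g₀ : Q) (hg₀ : χ g₀ ∉ P)
    (H : ∀ n : Q → ℤ, ∑ q, (n q : integralClosure ℤ E) * χ q ∈ P' →
      ∑ q, (n q : integralClosure ℤ E) * χ q ∈ P) : P' ≤ P := by
  intro a ha
  obtain ⟨n, hn⟩ := exists_coeff E χ a g₀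
  have h1 := coeff_self E χ hχ hgen a g₀ n hn
  have h2 := H n (by rw [h1]; exact P'.mul_mem_right _ ha)
  rw [h1] at h2
  exact (hP.mem_or_mem h2).resolve_right fun h => (hP.mem_or_mem h).elim hω hg₀

instance charField_fd {G : Type} [Group G] [Fintype G] (V : FDRep ℂ G) :
    FiniteDimensional ℚ V.charField := by
  apply IntermediateField.finiteDimensional_adjoin
  rintro _ ⟨g, rfl⟩
  exact (char_integral V g).tower_top

noncomputable def charO {G : Type} [Group G] [Fintype G] (V : FDRep ℂ G) (g : G) :
    integralClosure ℤ V.charField :=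
  ⟨⟨V.character g, IntermediateField.subset_adjoin ℚ _ ⟨g, rfl⟩⟩, by
    rw [mem_integralClosure_iff, ← isIntegral_algebraMap_iff (B := ℂ)
      (algebraMap V.charField ℂ).injective]
    exact char_integral V g⟩

lemma charO_coe {G : Type} [Group G] [Fintype G] (V : FDRep ℂ G) (g : G) :
    ((charO V g : V.charField) : ℂ) = V.character g := rfl

lemma charO_data {G : Type} [Group G] [Fintype G] (V : FDRep ℂ G) [Simple V] (M : Subgroup G)
    [M.Normal] [Fintype (G ⧸ M)] (hM : V.repKer = M) :
    CharData (fun q : G ⧸ M => charO V q.out) V.omega (Module.finrank ℂ V) := by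
  subst hM
  exact CharData.of_map (embO V.charField V.charField.val) (embO_inj _ _) (charData V)

lemma charO_gen {G : Type} [Group G] [Fintype G] (V : FDRep ℂ G) (M : Subgroup G)
    [M.Normal] (hM : V.repKer = M) (σ : V.charField →ₐ[ℚ] ℂ)
    (h : ∀ q : G ⧸ M, σ (charO V q.out : V.charField) = ((charO V q.out : V.charField) : ℂ)) :
    σ = V.charField.val := by
  subst hM
  apply IntermediateField.algHom_ext_of_eq_adjoin ℚ (s := Set.range V.character) rfl
  rintro _ ⟨g, rfl⟩
  have h1 := h (QuotientGroup.mk g)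
  have h2 : charO V (QuotientGroup.mk g : G ⧸ V.repKer).out = charO V g :=
    Subtype.ext (Subtype.ext (char_out V g))
  rw [h2] at h1
  exact h1

instance intClos_noeth (E : IntermediateField ℚ ℂ) [FiniteDimensional ℚ E] :
    IsNoetherianRing (integralClosure ℤ E) :=
  IsIntegralClosure.isNoetherianRing ℤ ℚ E (integralClosure ℤ E)

instance intClos_finite (E : IntermediateField ℚ ℂ) [FiniteDimensional ℚ E] :
    Module.Finite ℤ (integralClosure ℤ E) :=
  IsIntegralClosure.finite ℤ ℚ E (integralClosure ℤ E)

end PSp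

namespace PSp

/-- translation action on functions -/
noncomputable def transRep (F : Type) {G Q k : Type} [Group G] [Group Q] [Field F] [Field k]
    [Algebra F k] (π : G →* Q) : Representation F G (Q → k) where
  toFun a := LinearMap.funLeft F k (fun x => x * π a)
  map_one' := by ext v x; simp [LinearMap.funLeft]
  map_mul' a b := by ext v x; simp [LinearMap.funLeft, mul_assoc]

lemma transRep_apply (F : Type) {G Q k : Type} [Group G] [Group Q] [Field F] [Field k]
    [Algebra F k] (π : G →* Q) (a : G) (v : Q → k) (x : Q) :
    transRep F π a v x = v (x * π a) := rfl

/-- the submodule of functions satisfying the character functional equation -/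
noncomputable def eqSub (F : Type) {Q k : Type} [Group Q] [Fintype Q] [Field F] [Field k]
    [Algebra F k] (χ : Q → k) (ω : ℕ) : Submodule F (Q → k) where
  carrier := {v | ∀ x g, ∑ h : Q, v (x * (h * g * h⁻¹)) = ω * χ g * v x}
  zero_mem' := by intro x g; simp
  add_mem' := by
    intro u v hu hv x g
    simp only [Pi.add_apply, Finset.sum_add_distrib]
    rw [hu x g, hv x g]; ring
  smul_mem' := by
    intro c v hv x g
    simp only [Pi.smul_apply, ← Finset.smul_sum]
    rw [hv x g, mul_smul_comm]

lemma eqSub_inv (F : Type) {G Q k : Type} [Group G] [Group Q] [Fintype Q] [Field F] [Field k]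
    [Algebra F k] (π : G →* Q) (χ : Q → k) (ω : ℕ) (a : G) (v : Q → k)
    (hv : v ∈ eqSub F χ ω) : transRep F π a v ∈ eqSub F χ ω := by
  intro x g
  simp only [transRep_apply]
  rw [← hv (x * π a) g, ← Equiv.sum_comp (Equiv.mulLeft (π a))]
  refine Finset.sum_congr rfl fun h _ => ?_
  congr 1
  simp only [Equiv.coe_mulLeft]
  group

lemma constr (F : Type) {G Q k : Type} [Group G] [Group Q] [Fintype Q] [Field F] [Field k]
    [Algebra F k] [Module.Finite F k] (π : G →* Q) (hπ : Function.Surjective π)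
    (χ : Q → k) (ω d : ℕ) (hχ : CharData χ ω d) (hω : (ω : k) ≠ 0) (g₀ : Q) (hg₀ : χ g₀ ≠ 0)
    (hker : ∀ K : Subgroup Q, K.Normal → ∀ _ : Fintype K, K ≠ ⊥ → ∀ g, ∑ n : K, χ (n * g) = 0) :
    ∃ W : FDRep F G, Simple W ∧ (∀ g, W.ρ g = 1 ↔ π g = 1) ∧
      ∀ s : Q → G, (∀ q, π (s q) = q) → ∀ n : Q → ℤ,
        (∀ w : W, ∑ q, n q • ∑ h, W.ρ (s h * s q * (s h)⁻¹) w = 0) ↔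
          ∑ q, (n q : k) * χ q = 0 := by
  classical
  let T : Set (Submodule F (Q → k)) :=
    {U | U ≤ eqSub F χ ω ∧ (∀ g, ∀ u ∈ U, transRep F π g u ∈ U) ∧ U ≠ ⊥}
  have hT : T.Nonempty := by
    refine ⟨eqSub F χ ω, le_rfl, fun g u hu => eqSub_inv F π χ ω g u hu, ?_⟩
    intro hbot
    have hm : χ ∈ eqSub F χ ω := by
      intro x g
      rw [hχ.conv]; ring
    rw [hbot, Submodule.mem_bot] at hm
    exact hg₀ (congrFun hm g₀)
  obtain ⟨U, ⟨hUS, hUi, hUb⟩, hmin⟩ :=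
    (wellFounded_lt (α := Submodule F (Q → k))).has_min T hT
  obtain ⟨u, huU, hu0⟩ := (Submodule.ne_bot_iff U).1 hUb
  refine ⟨FDRep.of (subRep (transRep F π) U hUi), ?_, ?_, ?_⟩
  · rw [simple_iff]
    refine ⟨⟨(⟨u, huU⟩ : U), fun h => hu0 (congrArg Subtype.val h)⟩, ?_⟩
    intro (Z : Submodule F U) hZ hZb
    have hmem : Z.map U.subtype ∈ T := by
      refine ⟨(Submodule.map_subtype_le U Z).trans hUS, ?_, ?_⟩
      · rintro g _ ⟨z, hz, rfl⟩
        exact ⟨_, hZ g z hz, rfl⟩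
      · intro h
        exact hZb (Submodule.map_injective_of_injective U.injective_subtype
          (h.trans (Submodule.map_bot _).symm))
    have h1 : Z.map U.subtype = U := by
      by_contra hne
      exact hmin _ hmem (lt_of_le_of_ne (Submodule.map_subtype_le U Z) hne)
    show Z = ⊤
    rw [eq_top_iff]
    rintro ⟨y, hy⟩ -
    rw [← h1] at hy
    obtain ⟨z, hz, rfl⟩ := hy
    exact hz
  · let K : Subgroup Q :=
      { carrier := {q | ∀ w ∈ U, ∀ x, w (x * q) = w x}
        one_mem' := by intro w _ x; simp
        mul_mem' := by
          intro a b ha hb w hw x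
          rw [← mul_assoc, hb w hw, ha w hw]
        inv_mem' := by
          intro a ha w hw x
          rw [← ha w hw]; simp }
    have hKN : K.Normal := by
      constructor
      intro n hn q w hw x
      obtain ⟨a, rfl⟩ := hπ q
      have := hn _ (hUi a⁻¹ w hw) (x * π a)
      simp only [transRep_apply, map_inv] at this
      simpa [mul_assoc] using this
    have hfin : Fintype K := Fintype.ofFinite _
    have hK : K = ⊥ := kernel_trivial χ ω hω g₀ hg₀ u hu0 (fun x g => hUS huU x g) K
      (fun x n hn => hn u huU x) (hker K hKN hfin)
    intro g
    constructor
    · intro h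
      have : π g ∈ K := by
        intro w hw x
        have h2 := LinearMap.congr_fun h (⟨w, hw⟩ : U)
        exact congrFun (congrArg Subtype.val h2) x
      rw [hK] at this
      exact this
    · intro h
      apply LinearMap.ext
      intro w
      apply Subtype.ext
      funext x
      show (w : U).1 (x * π g) = (w : U).1 x
      rw [h, mul_one]
  · intro s hs n
    have key : ∀ w : U, ∀ x, ((∑ q, n q • ∑ h, subRep (transRep F π) U hUi
        (s h * s q * (s h)⁻¹) w : U) : Q → k) x = ω * (∑ q, (n q : k) * χ q) * w.1 x := by
      intro w x
      simp only [AddSubmonoidClass.coe_finsetSum, Submodule.coe_smul_of_tower, Finset.sum_apply,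
        Pi.smul_apply, subRep_apply, transRep_apply]
      simp only [map_mul, map_inv, hs]
      have h1 := fun q => hUS w.2 x q
      simp_rw [h1]
      rw [Finset.mul_sum, Finset.sum_mul]
      refine Finset.sum_congr rfl fun q _ => ?_
      rw [zsmul_eq_mul]; ring
    constructor
    · intro h
      obtain ⟨x, hx⟩ : ∃ x, u x ≠ 0 := by
        by_contra! h
        exact hu0 (funext h)
      have h1 := key ⟨u, huU⟩ x
      have h2 := congrFun (congrArg Subtype.val (h (⟨u, huU⟩ : U))) x
      have h3 := h1.symm.trans h2
      have h4 : (ω * (∑ q, (n q : k) * χ q) * u x) = 0 := h3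
      simpa [hω, hx] using h4
    · intro h w
      apply Subtype.ext
      funext x
      refine (key w x).trans ?_
      rw [h, mul_zero, zero_mul]
      rfl

end PSp

namespace PSp

noncomputable instance quotFintype {G : Type} [Group G] [Fintype G] (M : Subgroup G) :
    Fintype (G ⧸ M) := Fintype.ofFinite _

def Rel {F G : Type} [Field F] [Group G] [Fintype G] (V : FDRep ℂ G)
    (P : Ideal (integralClosure ℤ V.charField)) (W : FDRep F G) : Prop :=
  (∀ g, W.ρ g = 1 ↔ g ∈ V.repKer) ∧
    ∀ n : G ⧸ V.repKer → ℤ,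
      (∀ w : W, ∑ q, n q • ∑ h : G ⧸ V.repKer, W.ρ (Quotient.out h * Quotient.out q * (Quotient.out h)⁻¹) w = 0) ↔
        ∑ q, (n q : integralClosure ℤ V.charField) * charO V (Quotient.out q) ∈ P

lemma Rel.of_iso {F G : Type} [Field F] [Group G] [Fintype G] {V : FDRep ℂ G}
    {P : Ideal (integralClosure ℤ V.charField)} {W W' : FDRep F G} (h : Rel V P W)
    (i : W ≅ W') : Rel V P W' := by
  let e : W ≃ₗ[F] W' := FDRep.isoToLinearEquiv i
  have he : ∀ g w, e (W.ρ g w) = W'.ρ g (e w) := fun g w => toLin_comm i.hom g w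
  refine ⟨fun g => ?_, fun n => ?_⟩
  · rw [← h.1 g]
    constructor
    · intro h1
      ext w
      apply e.injective
      rw [he, h1]; rfl
    · intro h1
      ext w
      obtain ⟨w, rfl⟩ := e.surjective w
      rw [← he, h1]; rfl
  · rw [← h.2 n]
    have key : ∀ w : W, e (∑ q, n q • ∑ h : G ⧸ V.repKer,
          W.ρ (Quotient.out h * Quotient.out q * (Quotient.out h)⁻¹) w) =
        ∑ q, n q • ∑ h : G ⧸ V.repKer,
          W'.ρ (Quotient.out h * Quotient.out q * (Quotient.out h)⁻¹) (e w) := by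
      intro w
      simp only [map_sum, map_zsmul, he]
    constructor
    · intro h1 w
      apply e.injective
      rw [key, h1, map_zero]
    · intro h1 w
      obtain ⟨w, rfl⟩ := e.surjective w
      rw [← key, h1, map_zero]

lemma constr' {G Q O : Type} [Group G] [Group Q] [Fintype Q] [CommRing O] [IsDomain O]
    [IsNoetherianRing O] [CharZero O] [Module.Finite ℤ O] (p : ℕ) [hp : Fact p.Prime]
    (P : Ideal O) [hP : P.IsPrime] (hpP : (p : O) ∈ P)
    (π : G →* Q) (hπ : Function.Surjective π)
    (χ : Q → O) (ω d : ℕ) (hD : CharData χ ω d) (hV : ¬ p ∣ ω)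
    (hker : ∀ K : Subgroup Q, K.Normal → ∀ _ : Fintype K, K ≠ ⊥ → ∀ g, ∑ n : K, χ (n * g) = 0) :
    ∃ W : FDRep (ZMod p) G, Simple W ∧ (∀ g, W.ρ g = 1 ↔ π g = 1) ∧
      ∀ s : Q → G, (∀ q, π (s q) = q) → ∀ n : Q → ℤ,
        (∀ w : W, ∑ q, n q • ∑ h, W.ρ (s h * s q * (s h)⁻¹) w = 0) ↔
          ∑ q, (n q : O) * χ q ∈ P := by
  have hpk : (p : O ⧸ P) = 0 := by
    rw [← map_natCast (Ideal.Quotient.mk P)]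
    exact Ideal.Quotient.eq_zero_iff_mem.2 hpP
  have : CharP (O ⧸ P) p := (CharP.charP_iff_prime_eq_zero hp.out).2 hpk
  letI : Algebra (ZMod p) (O ⧸ P) := ZMod.algebra _ p
  have : Module.Finite ℤ (O ⧸ P) :=
    Module.Finite.of_surjective (Ideal.Quotient.mk P).toAddMonoidHom.toIntLinearMap
      Ideal.Quotient.mk_surjective
  have : Module.Finite (ZMod p) (O ⧸ P) := Module.Finite.of_restrictScalars_finite ℤ (ZMod p) _
  have : Finite (O ⧸ P) := Module.finite_of_finite (ZMod p)
  have hmax : P.IsMaximal := Ideal.Quotient.maximal_of_isField P (Finite.isField_of_domain _)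
  letI : Field (O ⧸ P) := Ideal.Quotient.field P
  obtain ⟨g₀, hg₀⟩ := hD.exists_notMem P hp.out hpP hV
  have hω := nat_notMem P hp.out hpP hV
  let f : O →+* O ⧸ P := Ideal.Quotient.mk P
  have hf : ∀ a : O, f a = 0 ↔ a ∈ P := fun a => Ideal.Quotient.eq_zero_iff_mem
  obtain ⟨W, hW, h1, h2⟩ := constr (ZMod p) π hπ (fun q => f (χ q)) ω
    d (hD.map f) (by rw [← map_natCast f, Ne, hf]; exact hω) g₀
    (by rw [Ne, hf]; exact hg₀) (by
      intro K hK hF hKb g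
      rw [← map_sum, hf, hker K hK hF hKb g]
      exact P.zero_mem)
  refine ⟨W, hW, h1, fun s hs n => ?_⟩
  rw [h2 s hs n, ← hf]
  simp only [map_sum, map_mul, map_intCast]

lemma exists_rel {G : Type} [Group G] [Fintype G] (p : ℕ) [hp : Fact p.Prime] (V : FDRep ℂ G)
    [Simple V] (hV : V.IsPSpecial p) (P : Ideal (integralClosure ℤ V.charField))
    [hP : P.IsPrime] (hpP : (p : integralClosure ℤ V.charField) ∈ P) :
    ∃ W : FDRep (ZMod p) G, Simple W ∧ Rel V P W := by
  have hD := charO_data V V.repKer rfl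
  obtain ⟨W, hW, h1, h2⟩ := constr' p P hpP (QuotientGroup.mk' V.repKer)
    (QuotientGroup.mk'_surjective _) (fun q => charO V (Quotient.out q)) V.omega
    (Module.finrank ℂ V) hD hV (by
      intro K hK _ hKb g
      apply embO_inj V.charField V.charField.val
      rw [map_sum, map_zero]
      exact char_normal_sum V K hKb g)
  refine ⟨W, hW, fun g => ?_, fun n => ?_⟩
  · rw [h1]
    exact QuotientGroup.eq_one_iff g
  · exact h2 (fun q => Quotient.out q) (fun q => QuotientGroup.out_eq' q) n

lemma Rel.cast {F G : Type} [Field F] [Group G] [Fintype G] {V : FDRep ℂ G}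
    {P : Ideal (integralClosure ℤ V.charField)} {W : FDRep F G} (h : Rel V P W)
    (M : Subgroup G) (hM : V.repKer = M) : ∀ n : G ⧸ M → ℤ,
      (∀ w : W, ∑ q, n q • ∑ h : G ⧸ M, W.ρ (Quotient.out h * Quotient.out q * (Quotient.out h)⁻¹) w = 0) ↔
        ∑ q, (n q : integralClosure ℤ V.charField) * charO V (Quotient.out q) ∈ P := by
  subst hM
  exact h.2

lemma char_out' {G : Type} [Group G] (V : FDRep ℂ G) (M : Subgroup G) (hM : V.repKer = M) (g : G) :
    V.character (QuotientGroup.mk g : G ⧸ M).out = V.character g := by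
  subst hM
  exact char_out V g

lemma rel_conj {F G : Type} [Field F] [Group G] [Fintype G] (p : ℕ) [hp : Fact p.Prime]
    (V V' : FDRep ℂ G) [Simple V] [Simple V'] (hV : V.IsPSpecial p)
    (P : Ideal (integralClosure ℤ V.charField)) (P' : Ideal (integralClosure ℤ V'.charField))
    [hP : P.IsPrime] (hpP : (p : integralClosure ℤ V.charField) ∈ P) (W : FDRep F G)
    (h : Rel V P W) (h' : Rel V' P' W) :
    ∃ σ : V.charField →ₐ[ℚ] ℂ, ∀ g, σ (charO V g : V.charField) = V'.character g := by
  have hM : V'.repKer = V.repKer := by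
    ext g
    rw [← h.1, ← h'.1]
  have hD := charO_data V V.repKer rfl
  obtain ⟨g₀, hg₀⟩ := hD.exists_notMem P hp.out hpP hV
  obtain ⟨σ, hσ⟩ := conj_of_cong V.charField V'.charField _ hD (charO_gen V V.repKer rfl) _
    (charO_data V' V.repKer hM) P P' (nat_notMem P hp.out hpP hV) g₀ hg₀
    (fun n hn => (h.2 n).1 ((h'.cast V.repKer hM n).2 hn))
  refine ⟨σ, fun g => ?_⟩
  have h1 := hσ (QuotientGroup.mk g)
  have h2 : charO V (QuotientGroup.mk g : G ⧸ V.repKer).out = charO V g :=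
    Subtype.ext (Subtype.ext (char_out V g))
  rw [h2, charO_coe, char_out' V' V.repKer hM] at h1
  exact h1

lemma rel_le {F G : Type} [Field F] [Group G] [Fintype G] (p : ℕ) [hp : Fact p.Prime]
    (V : FDRep ℂ G) [Simple V] (hV : V.IsPSpecial p)
    (P P' : Ideal (integralClosure ℤ V.charField))
    [hP : P.IsPrime] (hpP : (p : integralClosure ℤ V.charField) ∈ P) (W : FDRep F G)
    (h : Rel V P W) (h' : Rel V P' W) : P' ≤ P := by
  have hD := charO_data V V.repKer rfl
  obtain ⟨g₀, hg₀⟩ := hD.exists_notMem P hp.out hpP hV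
  exact ideal_le_of_cong V.charField _ hD (charO_gen V V.repKer rfl)
    P P' (nat_notMem P hp.out hpP hV) g₀ hg₀
    (fun n hn => (h.2 n).1 ((h'.2 n).2 hn))

lemma exists_rel_skel {G : Type} [Group G] [Fintype G] (p : ℕ) [hp : Fact p.Prime] (V : FDRep ℂ G)
    [Simple V] (hV : V.IsPSpecial p) (P : Ideal (integralClosure ℤ V.charField))
    [hP : P.IsPrime] (hpP : (p : integralClosure ℤ V.charField) ∈ P) :
    ∃ W : {W : Skeleton (FDRep (ZMod p) G) // Simple ((fromSkeleton (FDRep (ZMod p) G)).obj W)},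
      Rel V P ((fromSkeleton (FDRep (ZMod p) G)).obj W.1) := by
  obtain ⟨W, hW, hR⟩ := exists_rel p V hV P hpP
  have i : (fromSkeleton (FDRep (ZMod p) G)).obj (toSkeleton W) ≅ W := fromSkeletonToSkeletonIso W
  exact ⟨⟨toSkeleton W, Simple.of_iso i⟩, hR.of_iso i.symm⟩

end PSp

namespace PSp

lemma count {X Y : Type*} [Finite Y] (T : Finset X) (t m : X → ℕ) (r : X → Y → Prop)
    (ht : ∀ V ∈ T, t V ≤ Nat.card {y // r V y})
    (hm : ∀ V₀ ∈ T, ∀ y, r V₀ y → Nat.card {V // V ∈ T ∧ r V y} ≤ m V₀) :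
    ∑ V ∈ T, (t V : ℚ) / m V ≤ Nat.card Y := by
  classical
  have : Fintype Y := Fintype.ofFinite _
  calc ∑ V ∈ T, (t V : ℚ) / m V ≤ ∑ V ∈ T, ∑ y : Y, if r V y then (1 : ℚ) / m V else 0 := by
        refine Finset.sum_le_sum fun V hV => ?_
        rw [← Finset.sum_filter, Finset.sum_const, nsmul_eq_mul, mul_one_div]
        have h := ht V hV
        rw [Nat.card_eq_fintype_card, Fintype.card_subtype] at h
        gcongr
    _ = ∑ y : Y, ∑ V ∈ T, if r V y then (1 : ℚ) / m V else 0 := Finset.sum_comm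
    _ ≤ ∑ y : Y, (1 : ℚ) := by
        refine Finset.sum_le_sum fun y _ => ?_
        rw [← Finset.sum_filter]
        set D := T.filter (fun V => r V y) with hD
        have hcard : Nat.card {V // V ∈ T ∧ r V y} = D.card := by
          have : ∀ V, (V ∈ T ∧ r V y) ↔ V ∈ D := fun V => by rw [hD, Finset.mem_filter]
          simp_rw [this]
          simp
        rcases D.eq_empty_or_nonempty with h0 | h0
        · rw [h0]; simp
        have hpos : (0 : ℚ) < D.card := by exact_mod_cast Finset.card_pos.2 h0
        calc ∑ V ∈ D, (1 : ℚ) / m V ≤ ∑ V ∈ D, (1 : ℚ) / D.card := by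
              refine Finset.sum_le_sum fun V hV => ?_
              have hV' := Finset.mem_filter.1 hV
              have h := hm V hV'.1 y hV'.2
              rw [hcard] at h
              gcongr
          _ = 1 := by
              rw [Finset.sum_const, nsmul_eq_mul]
              field_simp
    _ = Nat.card Y := by simp

end PSp

theorem stmt0 (G : Type) [Group G] [Fintype G] (p : ℕ) [Fact p.Prime]
    (hdvd : p ∣ Fintype.card G) :
    (∑ᶠ V ∈ {V : Skeleton (FDRep ℂ G) |
        Simple ((fromSkeleton (FDRep ℂ G)).obj V) ∧
        ((fromSkeleton (FDRep ℂ G)).obj V).IsPSpecial p},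
      ((FDRep.numPrimesOver p ((fromSkeleton (FDRep ℂ G)).obj V) : ℚ) /
        (Module.finrank ℚ ((fromSkeleton (FDRep ℂ G)).obj V).charField : ℚ)))
      ≤ (Nat.card {W : Skeleton (FDRep (ZMod p) G) //
          Simple ((fromSkeleton (FDRep (ZMod p) G)).obj W)} : ℚ) := by
  classical
  have hfin := PSp.finite_simples (ZMod p) G
  set S : Set (Skeleton (FDRep ℂ G)) := {V : Skeleton (FDRep ℂ G) |
        Simple ((fromSkeleton (FDRep ℂ G)).obj V) ∧
        ((fromSkeleton (FDRep ℂ G)).obj V).IsPSpecial p} with hS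
  set f : Skeleton (FDRep ℂ G) → ℚ := fun V =>
    ((FDRep.numPrimesOver p ((fromSkeleton (FDRep ℂ G)).obj V) : ℚ) /
        (Module.finrank ℚ ((fromSkeleton (FDRep ℂ G)).obj V).charField : ℚ)) with hf
  change ∑ᶠ V ∈ S, f V ≤ _
  by_cases hs : (S ∩ Function.support f).Finite
  swap
  · rw [finsum_mem_eq_zero_of_infinite hs]
    positivity
  rw [← finsum_mem_inter_support, finsum_mem_eq_finite_toFinset_sum f hs]
  refine PSp.count _ _ _ (fun V W => ∃ P : Ideal (integralClosure ℤ
    ((fromSkeleton (FDRep ℂ G)).obj V).charField),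
    (P.IsPrime ∧ (p : integralClosure ℤ ((fromSkeleton (FDRep ℂ G)).obj V).charField) ∈ P) ∧
      PSp.Rel ((fromSkeleton (FDRep ℂ G)).obj V) P
        ((fromSkeleton (FDRep (ZMod p) G)).obj W.1)) ?_ ?_
  · intro V hV
    obtain ⟨hV1, hV2⟩ : V ∈ S := (hs.mem_toFinset.1 hV).1
    have key : ∀ P : {P : Ideal (integralClosure ℤ
        ((fromSkeleton (FDRep ℂ G)).obj V).charField) // P.IsPrime ∧
        (p : integralClosure ℤ ((fromSkeleton (FDRep ℂ G)).obj V).charField) ∈ P}, _ := fun P =>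
      haveI := P.2.1
      PSp.exists_rel_skel p ((fromSkeleton (FDRep ℂ G)).obj V) hV2 P.1 P.2.2
    choose w hw using key
    refine Nat.card_le_card_of_injective (fun P => ⟨w P, P.1, P.2, hw P⟩) ?_
    intro P P' h
    have h1 : w P = w P' := congrArg Subtype.val h
    have h2 := hw P'
    rw [← h1] at h2
    haveI := P.2.1
    haveI := P'.2.1
    exact Subtype.ext (le_antisymm
      (PSp.rel_le p _ hV2 P'.1 P.1 P'.2.2 _ h2 (hw P))
      (PSp.rel_le p _ hV2 P.1 P'.1 P.2.2 _ (hw P) h2))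
  · rintro V₀ hV₀ y ⟨P, ⟨hP, hpP⟩, hR⟩
    obtain ⟨hV1, hV2⟩ : V₀ ∈ S := (hs.mem_toFinset.1 hV₀).1
    have hsimp : ∀ V, V ∈ hs.toFinset → Simple ((fromSkeleton (FDRep ℂ G)).obj V) :=
      fun V hV => (hs.mem_toFinset.1 hV).1.1
    rw [← AlgHom.card ℚ ((fromSkeleton (FDRep ℂ G)).obj V₀).charField ℂ,
      ← Nat.card_eq_fintype_card]
    have key : ∀ V : {V // V ∈ hs.toFinset ∧ ∃ P : Ideal (integralClosure ℤ
          ((fromSkeleton (FDRep ℂ G)).obj V).charField),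
          (P.IsPrime ∧ (p : integralClosure ℤ
            ((fromSkeleton (FDRep ℂ G)).obj V).charField) ∈ P) ∧
          PSp.Rel ((fromSkeleton (FDRep ℂ G)).obj V) P
            ((fromSkeleton (FDRep (ZMod p) G)).obj y.1)},
        ∃ σ : ((fromSkeleton (FDRep ℂ G)).obj V₀).charField →ₐ[ℚ] ℂ, ∀ g,
          σ (PSp.charO ((fromSkeleton (FDRep ℂ G)).obj V₀) g :
            ((fromSkeleton (FDRep ℂ G)).obj V₀).charField) =
            ((fromSkeleton (FDRep ℂ G)).obj V.1).character g := by
      rintro ⟨V, hV, P', -, hR'⟩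
      haveI := hsimp V hV
      exact PSp.rel_conj p _ _ hV2 P P' hpP _ hR hR'
    choose σ hσ using key
    refine Nat.card_le_card_of_injective σ ?_
    intro V V' h
    apply Subtype.ext
    apply PSp.skel_eq
    haveI := hsimp V.1 V.2.1
    haveI := hsimp V'.1 V'.2.1
    apply PSp.iso_of_char_eq
    funext g
    rw [← hσ, ← hσ, h]
end

section
/- Let G be a finite group, p a prime dividing the order of G, and let φ₁, φ₂ be two p-special irreducible complex representations of G whose characters agree on every p-regular element of G (that is, χ_{φ₁}(g) = χ_{φ₂}(g) whenever the order of g is not divisible by p). Then φ₁ and φ₂ are isomorphic (equivalently, χ_{φ₁} = χ_{φ₂} on all of G). -/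
open CategoryTheory

theorem aux_orbit_sum {X : Type} [Fintype X] (σ : Equiv.Perm X) (f : X → ℂ)
    (hf : ∀ x, f (σ x) = f x) (hi : ∀ x, IsIntegral ℤ (f x)) (N : ℕ)
    (hN : ∀ x, f x ≠ 0 → N ∣ Function.minimalPeriod σ x) :
    ∃ s : ℂ, IsIntegral ℤ s ∧ ∑ x, f x = N * s := by
  classical
  have hz : ∀ (g : Subgroup.zpowers σ) x, f (g • x) = f x := by
    rintro ⟨g, hg⟩ x
    obtain ⟨k, rfl⟩ := hg
    show f ((σ ^ k) x) = f x
    induction k with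
    | zero => simp
    | succ n ih =>
      rw [add_comm, zpow_add, zpow_one, Equiv.Perm.mul_apply, hf, ih]
    | pred n ih =>
      rw [← hf, ← Equiv.Perm.mul_apply]
      convert ih using 3
      rw [← zpow_one_add]
      congr 1
      ring
  let Ω := Quotient (MulAction.orbitRel (Subgroup.zpowers σ) X)
  have h1 : ∑ x, f x = ∑ ω : Ω, ∑ x with (Quotient.mk _ x : Ω) = ω, f x := by
    rw [Finset.sum_fiberwise]
  have h2 : ∀ ω : Ω, ∃ s : ℂ, IsIntegral ℤ s ∧
      ∑ x with (Quotient.mk _ x : Ω) = ω, f x = N * s := by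
    intro ω
    induction ω using Quotient.inductionOn with
    | h y =>
    have h3 : ∀ x ∈ Finset.univ.filter (fun x => (Quotient.mk _ x : Ω) = Quotient.mk _ y),
        f x = f y := by
      intro x hx
      simp only [Finset.mem_filter, Finset.mem_univ, true_and] at hx
      obtain ⟨g, rfl⟩ := Quotient.exact hx
      exact hz g y
    rw [Finset.sum_congr rfl h3, Finset.sum_const, nsmul_eq_mul]
    by_cases h0 : f y = 0
    · exact ⟨0, isIntegral_zero, by simp [h0]⟩
    have h4 : (Finset.univ.filter (fun x => (Quotient.mk _ x : Ω) = Quotient.mk _ y)).card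
        = Function.minimalPeriod σ y := by
      have := MulAction.minimalPeriod_eq_card (a := σ) (b := y)
      refine Eq.trans ?_ this.symm
      rw [← Set.toFinset_card]
      congr 1
      ext x
      simp only [Finset.mem_filter, Finset.mem_univ, true_and, Set.mem_toFinset]
      exact Quotient.eq
    obtain ⟨m, hm⟩ := hN y h0
    refine ⟨m * f y, (isIntegral_algebraMap (x := (m : ℤ))).mul (hi y), ?_⟩
    rw [h4, hm]; push_cast; ring
  choose s hs1 hs2 using h2
  refine ⟨∑ ω, s ω, IsIntegral.sum _ fun ω _ => hs1 ω, ?_⟩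
  rw [h1, Finset.mul_sum]
  exact Finset.sum_congr rfl fun ω _ => hs2 ω

theorem aux_words {Q : Type} [Group Q] [Fintype Q] (c : Q → ℂ) (r : ℂ)
    (hc : ∀ x, ∑ g, c g * c (g⁻¹ * x) = r * c x) (n : ℕ) :
    ∀ F : Q → ℂ, ∑ w : Fin (n+1) → Q, F (List.ofFn w).prod * ∏ i, c (w i)
      = r ^ n * ∑ x, F x * c x := by
  induction n with
  | zero =>
    intro F
    rw [← (Equiv.funUnique (Fin 1) Q).symm.sum_comp]
    simp
  | succ n ih =>
    intro F
    rw [← (Fin.consEquiv (fun _ : Fin (n+2) => Q)).sum_comp, Fintype.sum_prod_type]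
    simp only [Fin.consEquiv_apply, List.ofFn_succ, Fin.cons_zero, Fin.cons_succ, List.prod_cons,
      Fin.prod_univ_succ (n := n+1)]
    have h : ∀ a : Q, ∑ w : Fin (n+1) → Q, F (a * (List.ofFn w).prod) * (c a * ∏ i, c (w i))
        = c a * (r ^ n * ∑ x, F (a * x) * c x) := by
      intro a
      rw [← ih (fun x => F (a * x)), Finset.mul_sum]
      refine Finset.sum_congr rfl fun w _ => by ring
    simp only [List.ofFn_succ, List.prod_cons, Fin.prod_univ_succ] at h ⊢
    rw [Finset.sum_congr rfl fun a _ => h a]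
    have h2 : ∀ a : Q, ∑ x, F (a * x) * c x = ∑ y, F y * c (a⁻¹ * y) := by
      intro a
      rw [← Equiv.sum_comp (Equiv.mulLeft a) (fun y => F y * c (a⁻¹ * y))]
      simp
    simp_rw [h2, Finset.mul_sum]
    rw [Finset.sum_comm]
    refine Finset.sum_congr rfl fun y _ => ?_
    rw [pow_succ, mul_assoc (r^n), mul_left_comm r, ← hc y, Finset.mul_sum, Finset.mul_sum]
    refine Finset.sum_congr rfl fun a _ => by ring

theorem aux_div_zero (p : ℕ) (hp : p.Prime) (α : ℂ)
    (h : ∀ n, ∃ s : ℂ, IsIntegral ℤ s ∧ α = (p : ℂ) ^ n * s) : α = 0 := by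
  by_contra h0
  have hα : IsIntegral ℤ α := by
    obtain ⟨s, hs, e⟩ := h 0
    rw [e]; simpa using hs
  have hp0 : (p : ℂ) ≠ 0 := by exact_mod_cast hp.ne_zero
  -- a nonzero integer multiple
  obtain ⟨β, hβ, c, hc0, hc⟩ : ∃ β : ℂ, IsIntegral ℤ β ∧ ∃ c : ℤ, c ≠ 0 ∧ α * β = c := by
    have hal : IsAlgebraic ℤ α⁻¹ := hα.isAlgebraic.inv
    obtain ⟨c, hc, hi⟩ := hal.exists_integral_multiple
    refine ⟨_, hi, c, hc, ?_⟩
    rw [mul_smul_comm, mul_inv_cancel₀ h0]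
    simp
  have : ∀ n, (p : ℤ) ^ n ∣ c := by
    intro n
    obtain ⟨s, hs, e⟩ := h n
    have : IsIntegral ℤ (((c : ℚ) / p ^ n : ℚ) : ℂ) := by
      have : (((c : ℚ) / p ^ n : ℚ) : ℂ) = s * β := by
        push_cast
        rw [div_eq_iff (by positivity), ← hc, e]; ring
      rw [this]
      exact hs.mul hβ
    have h2 : IsIntegral ℤ ((c : ℚ) / p ^ n : ℚ) :=
      (isIntegral_algebraMap_iff (B := ℂ) (algebraMap ℚ ℂ).injective).1 this
    obtain ⟨k, hk⟩ := IsIntegrallyClosed.isIntegral_iff.1 h2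
    refine ⟨k, ?_⟩
    have hpq : (p : ℚ) ≠ 0 := by exact_mod_cast hp.ne_zero
    rw [eq_div_iff (by positivity)] at hk
    simp at hk
    exact_mod_cast (by rw [← hk]; ring : (c : ℚ) = p ^ n * k)
  have h3 : FiniteMultiplicity (p : ℤ) c :=
    Int.finiteMultiplicity_iff.2 ⟨by simpa using hp.ne_one, hc0⟩
  obtain ⟨n, hn⟩ := h3
  exact hn (this _)

theorem aux_period_prod {Q : Type} [Group Q] (W : ℕ → Q) (k : ℕ) (h : ∀ i, W (i + k) = W i)
    (m : ℕ) : ((List.range (k * m)).map W).prod = ((List.range k).map W).prod ^ m := by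
  have hm : ∀ m i, W (k * m + i) = W i := by
    intro m
    induction m with
    | zero => simp
    | succ m ih => intro i; rw [← ih i, ← h (k * m + i)]; congr 1; ring
  induction m with
  | zero => simp
  | succ m ih =>
    rw [mul_add, mul_one, List.range_add, List.map_append, List.prod_append, ih, pow_succ,
      List.map_map]
    congr 2
    exact List.map_congr_left fun i _ => hm m i

open scoped Fin.NatCast Fin.CommRing in
theorem aux_vanish {Q : Type} [Group Q] [Fintype Q] (p : ℕ) (hp : p.Prime) (c : Q → ℂ)
    (hconj : ∀ g x, c (g * x * g⁻¹) = c x) (hcint : ∀ x, IsIntegral ℤ (c x)) (m : ℕ)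
    (hm : ¬ p ∣ m) (hc : ∀ x, ∑ g, c g * c (g⁻¹ * x) = m * c x) (x : Q)
    (hx : p ∣ orderOf x) : c x = 0 := by
  classical
  set C := Finset.univ.filter (fun y => IsConj x y) with hC
  have hC0 : (C.card : ℂ) ≠ 0 := by
    rw [Nat.cast_ne_zero, ← Nat.pos_iff_ne_zero, Finset.card_pos]
    exact ⟨x, by rw [hC, Finset.mem_filter]; exact ⟨Finset.mem_univ _, IsConj.refl x⟩⟩
  let F : Q → ℂ := fun y => if IsConj x y then 1 else 0
  have hFc : ∑ y, F y * c y = C.card * c x := by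
    simp only [F, ite_mul, one_mul, zero_mul]
    rw [← Finset.sum_filter, ← nsmul_eq_mul, ← Finset.sum_const]
    refine Finset.sum_congr rfl fun y hy => ?_
    obtain ⟨g, rfl⟩ := isConj_iff.1 (Finset.mem_filter.1 hy).2
    exact hconj g x
  obtain ⟨a, u, hu, hau⟩ := Nat.exists_eq_pow_mul_and_not_dvd (n := Fintype.card Q)
    Fintype.card_ne_zero p hp.ne_one
  have key : ∀ n, ∃ s : ℂ, IsIntegral ℤ s ∧ C.card * c x = (p : ℂ) ^ n * s := by
    intro n
    obtain ⟨k, hk⟩ : ∃ k, p ^ (n + a) = k + 1 :=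
      ⟨p ^ (n+a) - 1, (Nat.sub_add_cancel (Nat.pow_pos hp.pos)).symm⟩
    have hw := aux_words c m hc k F
    rw [hFc] at hw
    let σ : Equiv.Perm (Fin (k+1) → Q) := Equiv.arrowCongr (Equiv.subRight 1) (Equiv.refl Q)
    have hσ : ∀ w i, σ w i = w (i + 1) := by
      intro w i; simp [σ, Equiv.arrowCongr]
    have hσj : ∀ j w i, (σ^[j]) w i = w (i + ((j : ℕ) : Fin (k+1))) := by
      intro j
      induction j with
      | zero => simp
      | succ j ih =>
        intro w i
        rw [Function.iterate_succ_apply', hσ, ih]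
        congr 1
        push_cast
        ring
    have hofFn : ∀ w : Fin (k+1) → Q,
        List.ofFn w = (List.range (k+1)).map (fun i : ℕ => w (i : Fin (k+1))) := by
      intro w
      apply List.ext_getElem
      · simp
      · intro i h1 h2
        rw [List.length_ofFn] at h1
        simp only [List.getElem_ofFn, List.getElem_map, List.getElem_range]
        congr 1
        ext
        simp [Fin.val_natCast, Nat.mod_eq_of_lt h1]
    have hrot : ∀ w : Fin (k+1) → Q, (List.ofFn (σ w)).prod
        = (w 0)⁻¹ * (List.ofFn w).prod * w 0 := by
      intro w
      have e1 := List.prod_range_succ (fun i : ℕ => w (i : Fin (k+1))) (k+1)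
      have e2 := List.prod_range_succ' (fun i : ℕ => w (i : Fin (k+1))) (k+1)
      rw [e1] at e2
      have e3 : (((k+1 : ℕ)) : Fin (k+1)) = 0 := by simp
      rw [e3] at e2
      rw [hofFn, hofFn, mul_assoc, e2]
      simp [hσ]
    suffices horb : ∃ s : ℂ, IsIntegral ℤ s ∧
        ∑ w : Fin (k+1) → Q, F (List.ofFn w).prod * ∏ i, c (w i) = ((p ^ n : ℕ) : ℂ) * s by
      obtain ⟨s, hs, e⟩ := horb
      rw [hw] at e
      have hcop : IsCoprime ((m : ℤ) ^ k) ((p : ℤ) ^ n) := by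
        apply IsCoprime.pow
        rw [Nat.isCoprime_iff_coprime]
        exact ((Nat.Prime.coprime_iff_not_dvd hp).2 hm).symm
      obtain ⟨A, B, hAB⟩ := hcop
      have hAB' : (A : ℂ) * m ^ k + B * p ^ n = 1 := by exact_mod_cast congrArg (Int.cast (R := ℂ)) hAB
      have hZ : ∀ z : ℤ, IsIntegral ℤ (z : ℂ) := fun z => isIntegral_algebraMap (x := z)
      refine ⟨A * s + B * (C.card * c x), ?_, ?_⟩
      · exact ((hZ A).mul hs).add ((hZ B).mul ((hZ C.card).mul (hcint x)))
      · push_cast at e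
        calc (C.card : ℂ) * c x = (A * m ^ k + B * p ^ n) * (C.card * c x) := by
              rw [hAB', one_mul]
          _ = A * (m ^ k * (C.card * c x)) + B * p ^ n * (C.card * c x) := by ring
          _ = _ := by rw [e]; ring
    refine aux_orbit_sum σ (fun w => F (List.ofFn w).prod * ∏ i, c (w i)) ?_ ?_ (p ^ n) ?_
    · intro w
      have h1 : F (List.ofFn (σ w)).prod = F (List.ofFn w).prod := by
        have : IsConj (List.ofFn (σ w)).prod (List.ofFn w).prod :=
          isConj_iff.2 ⟨w 0, by rw [hrot]; group⟩
        simp only [F]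
        congr 1
        exact propext ⟨fun h => h.trans this, fun h => h.trans this.symm⟩
      have h2 : ∏ i, c (σ w i) = ∏ i, c (w i) := by
        simp only [hσ]
        exact Equiv.prod_comp (Equiv.addRight (1 : Fin (k+1))) (fun i => c (w i))
      simp only [h1, h2]
    · intro w
      refine IsIntegral.mul ?_ (IsIntegral.prod _ fun i _ => hcint _)
      simp only [F]
      split_ifs
      · exact isIntegral_one
      · exact isIntegral_zero
    · intro w hw0
      have hcj : IsConj x (List.ofFn w).prod := by
        by_contra h
        exact hw0 (by simp only [F, if_neg h, zero_mul])
      have hper : Function.IsPeriodicPt σ (p ^ (n + a)) w := by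
        funext i
        rw [hσj, hk]; simp
      obtain ⟨t, ht, htt⟩ := (Nat.dvd_prime_pow hp).1 hper.minimalPeriod_dvd
      rw [htt]
      apply pow_dvd_pow
      by_contra hlt
      have h1 : Function.IsPeriodicPt σ (p ^ t) w := htt ▸ Function.isPeriodicPt_minimalPeriod σ w
      have h2 : ∀ i : ℕ, w ((i + p ^ t : ℕ) : Fin (k+1)) = w (i : Fin (k+1)) := by
        intro i
        have := congrFun h1 (i : Fin (k+1))
        rw [hσj] at this
        rw [← this]
        congr 1
        push_cast
        rfl
      have h3 := aux_period_prod (fun i : ℕ => w (i : Fin (k+1))) (p ^ t) h2 (p ^ (n + a - t))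
      rw [← pow_add, Nat.add_sub_cancel' ht, hk, ← hofFn] at h3
      set g := ((List.range (p ^ t)).map (fun i : ℕ => w (i : Fin (k+1)))).prod
      have h4 : (List.ofFn w).prod ^ u = 1 := by
        rw [h3, ← pow_mul]
        obtain ⟨b, hb⟩ := Nat.exists_eq_add_of_lt (not_le.1 hlt)
        have : n + a - t = a + (b + 1) := by omega
        rw [this, pow_add, mul_right_comm, ← hau, pow_mul, pow_card_eq_one, one_pow]
      have h5 : x ^ u = 1 := by
        obtain ⟨g, hg⟩ := isConj_iff.1 hcj
        rw [← hg, conj_pow] at h4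
        simpa using h4
      exact hu (hx.trans (orderOf_dvd_of_pow_eq_one h5))
  exact (mul_eq_zero.1 (aux_div_zero p hp _ key)).resolve_left hC0

theorem aux_dvd {Q : Type} [Group Q] [Fintype Q] (c : Q → ℂ)
    (hcint : ∀ x, IsIntegral ℤ (c x)) (d : ℕ) (hd : d ≠ 0) (h1 : c 1 = d)
    (hc : ∀ x, ∑ g, c g * c (g⁻¹ * x) = ((Fintype.card Q : ℂ) / d) * c x) :
    d ∣ Fintype.card Q := by
  classical
  set r : ℂ := (Fintype.card Q : ℂ) / d with hr
  let M : Matrix Q Q (integralClosure ℤ ℂ) := fun x y => ⟨c (x * y⁻¹), hcint _⟩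
  let M' : Matrix Q Q ℂ := M.map (algebraMap (integralClosure ℤ ℂ) ℂ)
  have hM' : ∀ x y, M' x y = c (x * y⁻¹) := fun x y => rfl
  have hv : M'.mulVec c = r • c := by
    funext x
    simp only [Matrix.mulVec, dotProduct, hM', Pi.smul_apply, smul_eq_mul]
    rw [← hc x, ← (Equiv.inv Q).trans (Equiv.mulRight x) |>.sum_comp]
    refine Finset.sum_congr rfl fun g _ => ?_
    simp
  have hroot : M'.charpoly.IsRoot r := by
    rw [← Matrix.charpoly_toLin', ← Module.End.hasEigenvalue_iff_isRoot_charpoly]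
    refine Module.End.hasEigenvalue_of_hasEigenvector (x := c) ⟨?_, ?_⟩
    · rw [Module.End.mem_eigenspace_iff, Matrix.toLin'_apply, hv]
    · intro h
      rw [h, Pi.zero_apply] at h1
      exact hd (by exact_mod_cast h1.symm)
  have hri : IsIntegral (integralClosure ℤ ℂ) r := by
    refine ⟨M.charpoly, M.charpoly_monic, ?_⟩
    rw [Polynomial.eval₂_eq_eval_map, ← Matrix.charpoly_map]
    exact hroot
  have hri' : IsIntegral ℤ r := isIntegral_trans r hri
  have hrq : r = algebraMap ℚ ℂ ((Fintype.card Q : ℚ) / d) := by simp [hr]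
  rw [hrq] at hri'
  have h2 := (isIntegral_algebraMap_iff (algebraMap ℚ ℂ).injective).1 hri'
  obtain ⟨k, hk⟩ := IsIntegrallyClosed.isIntegral_iff.1 h2
  rw [eq_div_iff (by exact_mod_cast hd)] at hk
  simp at hk
  have hk' : k * (d : ℤ) = Fintype.card Q := by exact_mod_cast hk
  exact Int.natCast_dvd_natCast.1 ⟨k, by rw [← hk']; ring⟩

theorem aux_schur_finrank {G : Type} [Group G] (V : FDRep ℂ G) [Simple V] :
    Module.finrank ℂ (Representation.invariants (Representation.linHom V.ρ V.ρ)) = 1 := by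
  rw [(Representation.linHom.invariantsEquivFDRepHom V V).finrank_eq]
  exact finrank_endomorphism_simple_eq_one ℂ V

theorem aux_dim_ne_zero {G : Type} [Group G] (V : FDRep ℂ G) [Simple V] :
    Module.finrank ℂ V ≠ 0 := by
  intro h
  have := Module.finrank_zero_iff.1 h
  have h1 := aux_schur_finrank V
  have : Subsingleton (V →ₗ[ℂ] V) := inferInstance
  rw [Module.finrank_zero_of_subsingleton] at h1
  exact zero_ne_one h1

theorem aux_schur {G : Type} [Group G] (V : FDRep ℂ G) [Simple V] (T : V →ₗ[ℂ] V)
    (hT : ∀ g, V.ρ g * T = T * V.ρ g) : ∃ c : ℂ, T = c • (1 : V →ₗ[ℂ] V) := by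
  have hm : ∀ S : V →ₗ[ℂ] V, (∀ g, V.ρ g * S = S * V.ρ g) →
      S ∈ Representation.invariants (Representation.linHom V.ρ V.ρ) := by
    intro S hS g
    show V.ρ g * (S * V.ρ g⁻¹) = S
    rw [← mul_assoc, hS, mul_assoc, ← map_mul, mul_inv_cancel, map_one, mul_one]
  have hne : (1 : V →ₗ[ℂ] V) ≠ 0 := by
    have : Nontrivial V := Module.nontrivial_of_finrank_pos (R := ℂ)
      (Nat.pos_of_ne_zero (aux_dim_ne_zero V))
    exact one_ne_zero
  have h := (finrank_eq_one_iff_of_nonzero'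
    (⟨1, hm 1 fun g => by rw [mul_one, one_mul]⟩ :
      Representation.invariants (Representation.linHom V.ρ V.ρ))
    (fun h => hne (congrArg Subtype.val h))).1 (aux_schur_finrank V) ⟨T, hm T hT⟩
  obtain ⟨c, hc⟩ := h
  exact ⟨c, (congrArg Subtype.val hc).symm⟩

theorem aux_char_integral {G : Type} [Group G] [Fintype G] (V : FDRep ℂ G) (g : G) :
    IsIntegral ℤ (V.character g) := by
  unfold FDRep.character
  rw [Module.End.trace_eq_sum_roots_charpoly_of_splits (IsAlgClosed.splits _)]
  apply IsIntegral.multiset_sum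
  intro μ hμ
  rw [Polynomial.mem_roots (LinearMap.charpoly_monic _).ne_zero,
    ← Module.End.hasEigenvalue_iff_isRoot_charpoly] at hμ
  obtain ⟨v, hv⟩ := hμ.exists_hasEigenvector
  have h := hv.pow_apply (Fintype.card G)
  rw [← map_pow, pow_card_eq_one, map_one] at h
  have h2 : μ ^ Fintype.card G = 1 := by
    have h3 : ((1 : ℂ) - μ ^ Fintype.card G) • v = 0 := by
      rw [sub_smul, ← h]; simp
    rcases smul_eq_zero.1 h3 with h4 | h4
    · exact (sub_eq_zero.1 h4).symm
    · exact absurd h4 hv.2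
  exact IsIntegral.of_pow Fintype.card_pos (h2 ▸ isIntegral_one)

theorem aux_conv {G : Type} [Group G] [Fintype G] (V : FDRep ℂ G) [Simple V] (x : G) :
    ∑ g, V.character g * V.character (g⁻¹ * x)
      = ((Fintype.card G : ℂ) / Module.finrank ℂ V) * V.character x := by
  have hd : (Module.finrank ℂ V : ℂ) ≠ 0 := by exact_mod_cast aux_dim_ne_zero V
  obtain ⟨r, hr⟩ := aux_schur V (∑ g, V.character g • V.ρ g⁻¹) (by
    intro h
    rw [Finset.mul_sum, Finset.sum_mul,
      ← Equiv.sum_comp (MulAut.conj h⁻¹).toEquiv]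
    refine Finset.sum_congr rfl fun g _ => ?_
    have h1 : V.character ((MulAut.conj h⁻¹).toEquiv g) = V.character g := by
      simpa using V.char_conj g h⁻¹
    rw [h1, mul_smul_comm, smul_mul_assoc, ← map_mul, ← map_mul]
    congr 2
    simp [mul_assoc])
  have htr : ∀ y, ∑ g, V.character g * V.character (g⁻¹ * y) = r * V.character y := by
    intro y
    have := congrArg (fun S => LinearMap.trace ℂ V (S * V.ρ y)) hr
    simp only [Finset.sum_mul, map_sum, smul_mul_assoc, one_mul, map_smul, ← map_mul,
      smul_eq_mul] at this
    exact this
  have h1 := htr 1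
  have : Invertible (Nat.card G : ℂ) := invertibleOfNonzero (by simp)
  have ho := FDRep.char_orthonormal V V
  rw [if_pos ⟨Iso.refl V⟩, inv_mul_eq_iff_eq_mul₀ (by simp)] at ho
  simp only [mul_one] at h1
  rw [ho, FDRep.char_one] at h1
  rw [htr, ← Nat.card_eq_fintype_card, eq_div_of_mul_eq hd h1.symm]
  simp

theorem aux_sum_quot {G : Type} [Group G] [Fintype G] (N : Subgroup G) [N.Normal]
    [Fintype (G ⧸ N)] (f : G ⧸ N → ℂ) :
    ∑ g : G, f (g : G ⧸ N) = Nat.card N * ∑ q, f q := by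
  classical
  rw [← Finset.sum_fiberwise Finset.univ (fun g : G => (g : G ⧸ N)), Finset.mul_sum]
  refine Finset.sum_congr rfl fun q _ => ?_
  rw [Finset.sum_congr rfl (g := fun _ => f q) (by
    intro x hx; rw [(Finset.mem_filter.1 hx).2]), Finset.sum_const, nsmul_eq_mul]
  congr 2
  have h1 := MonoidHom.card_fiber_eq_of_mem_range (QuotientGroup.mk' N) (x := q) (y := 1)
    (QuotientGroup.mk'_surjective N q) (QuotientGroup.mk'_surjective N 1)
  refine h1.trans ?_
  rw [Nat.card_eq_fintype_card, Fintype.card_subtype]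
  congr 1
  ext x
  simp

theorem aux_char_mul_ker {G : Type} [Group G] (V : FDRep ℂ G) (g n : G) (hn : n ∈ V.repKer) :
    V.character (g * n) = V.character g := by
  have : V.ρ n = 1 := hn
  unfold FDRep.character
  rw [map_mul, this, mul_one]

theorem aux_special_vanish {G : Type} [Group G] [Fintype G] (p : ℕ) (hp : p.Prime)
    (V : FDRep ℂ G) [Simple V] (hs : V.IsPSpecial p) (g : G)
    (hg : p ∣ orderOf (g : G ⧸ V.repKer)) : V.character g = 0 := by
  classical
  set N := V.repKer with hN
  have hd0 := aux_dim_ne_zero V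
  have hd : (Module.finrank ℂ V : ℂ) ≠ 0 := by exact_mod_cast hd0
  have hN0 : (Nat.card N : ℂ) ≠ 0 := by exact_mod_cast Nat.card_pos.ne'
  let c : G ⧸ N → ℂ := fun q => Quotient.liftOn' q V.character (by
    intro a b hab
    rw [QuotientGroup.leftRel_apply] at hab
    have := aux_char_mul_ker V a _ hab
    rw [mul_inv_cancel_left] at this
    exact this.symm)
  have hcg : ∀ g : G, c (g : G ⧸ N) = V.character g := fun g => rfl
  have hcard : Fintype.card G = Nat.card N * Fintype.card (G ⧸ N) := by
    rw [← Nat.card_eq_fintype_card, ← Nat.card_eq_fintype_card, mul_comm]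
    exact Subgroup.card_eq_card_quotient_mul_card_subgroup N
  have hconv : ∀ x, ∑ q, c q * c (q⁻¹ * x)
      = ((Fintype.card (G ⧸ N) : ℂ) / Module.finrank ℂ V) * c x := by
    intro x
    obtain ⟨y, rfl⟩ := QuotientGroup.mk_surjective x
    have h1 := aux_sum_quot N (fun q => c q * c (q⁻¹ * (y : G ⧸ N)))
    have h2 := aux_conv V y
    rw [hcard] at h2
    have h3 : ∑ g : G, c (g : G ⧸ N) * c ((g : G ⧸ N)⁻¹ * (y : G ⧸ N))
      = ∑ g, V.character g * V.character (g⁻¹ * y) := rfl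
    rw [h3, h2] at h1
    apply mul_left_cancel₀ hN0
    rw [← h1, hcg]
    push_cast
    ring
  have hcint : ∀ x, IsIntegral ℤ (c x) := by
    intro x
    obtain ⟨y, rfl⟩ := QuotientGroup.mk_surjective x
    exact aux_char_integral V y
  obtain ⟨m, hm⟩ := aux_dvd c hcint _ hd0 (V.char_one) hconv
  have homega : V.omega = m := by
    unfold FDRep.omega
    rw [hcard, hm, ← mul_assoc]
    exact Nat.mul_div_cancel_left _ (Nat.mul_pos Nat.card_pos (Nat.pos_of_ne_zero hd0))
  have hpm : ¬ p ∣ m := homega ▸ hs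
  rw [← hcg]
  refine aux_vanish p hp c ?_ hcint m hpm ?_ _ hg
  · intro a b
    obtain ⟨a, rfl⟩ := QuotientGroup.mk_surjective a
    obtain ⟨b, rfl⟩ := QuotientGroup.mk_surjective b
    exact V.char_conj b a
  · intro x
    rw [hconv, hm]
    push_cast
    rw [mul_div_cancel_left₀ _ hd]

/-- For a `p`-special representation, the value at `g` is either that at the `p`-regular part
`g ^ k`, or zero. -/
theorem aux_special_value {G : Type} [Group G] [Fintype G] (p : ℕ) (hp : p.Prime)
    (V : FDRep ℂ G) [Simple V] (hs : V.IsPSpecial p) (a u k : ℕ)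
    (hau : Fintype.card G = p ^ a * u) (hk : k ≡ 1 [MOD u]) (g : G) :
    (g⁻¹ * g ^ k ∈ V.repKer → V.character g = V.character (g ^ k)) ∧
    (g⁻¹ * g ^ k ∉ V.repKer → V.character g = 0) := by
  constructor
  · intro h
    rw [← aux_char_mul_ker V g _ h, mul_inv_cancel_left]
  · intro h
    apply aux_special_vanish p hp V hs
    by_contra hnd
    apply h
    have h1 : orderOf (g : G ⧸ V.repKer) ∣ u := by
      have h2 : orderOf (g : G ⧸ V.repKer) ∣ p ^ a * u := by
        rw [← hau]
        apply orderOf_dvd_of_pow_eq_one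
        rw [← QuotientGroup.mk_pow, pow_card_eq_one, QuotientGroup.mk_one]
      exact (((Nat.Prime.coprime_iff_not_dvd hp).2 hnd).symm.pow_right a).dvd_of_dvd_mul_left h2
    have h3 : (g : G ⧸ V.repKer) ^ k = (g : G ⧸ V.repKer) ^ 1 :=
      pow_eq_pow_iff_modEq.2 (hk.of_dvd h1)
    rw [pow_one, ← QuotientGroup.mk_pow] at h3
    exact QuotientGroup.eq.1 h3.symm

theorem aux_ker_le {G : Type} [Group G] [Fintype G] (p : ℕ) (hp : p.Prime)
    (V W : FDRep ℂ G) [Simple V] [Simple W] (hW : W.IsPSpecial p) (a u k : ℕ)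
    (hau : Fintype.card G = p ^ a * u) (hk : k ≡ 1 [MOD u])
    (hreg : ∀ g : G, V.character (g ^ k) = W.character (g ^ k)) :
    V.repKer ≤ W.repKer := by
  classical
  have hd0 := aux_dim_ne_zero W
  have hdim : V.character 1 = W.character 1 := by simpa using hreg 1
  obtain ⟨r, hr⟩ := aux_schur W (∑ n : V.repKer, W.ρ n) (by
    intro h
    rw [Finset.mul_sum, Finset.sum_mul,
      ← Equiv.sum_comp (MulAut.conjNormal (H := V.repKer) h).toEquiv (fun n => W.ρ n * W.ρ h)]
    refine Finset.sum_congr rfl fun n _ => ?_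
    rw [← map_mul, ← map_mul]
    congr 1
    simp [MulAut.conjNormal_apply])
  have hval : ∀ n : V.repKer, W.character n = W.character 1 ∨ W.character n = 0 := by
    intro n
    by_cases h : (n : G)⁻¹ * (n : G) ^ k ∈ W.repKer
    · left
      rw [(aux_special_value p hp W hW a u k hau hk n).1 h, ← hreg, ← hdim]
      have : (n : G) ^ k ∈ V.repKer := pow_mem n.2 k
      simpa using aux_char_mul_ker V 1 _ this
    · right
      exact (aux_special_value p hp W hW a u k hau hk n).2 h
  have hsum : ∑ n : V.repKer, W.character n ≠ 0 := by
    have h1 : ∀ n : V.repKer, W.character n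
        = (((if W.character n = 0 then 0 else Module.finrank ℂ W : ℕ)) : ℂ) := by
      intro n
      split_ifs with h
      · simpa using h
      · rw [(hval n).resolve_right h, FDRep.char_one]
    rw [Finset.sum_congr rfl fun n _ => h1 n, ← Nat.cast_sum, Nat.cast_ne_zero,
      ← Nat.pos_iff_ne_zero]
    refine Finset.sum_pos' (fun _ _ => Nat.zero_le _) ⟨1, Finset.mem_univ _, ?_⟩
    rw [if_neg]
    · exact Nat.pos_of_ne_zero hd0
    · rw [OneMemClass.coe_one, FDRep.char_one]
      exact_mod_cast hd0
  have hr0 : r ≠ 0 := by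
    rintro rfl
    apply hsum
    have := congrArg (LinearMap.trace ℂ W) hr
    rw [map_sum, zero_smul, map_zero] at this
    exact this
  intro n hn
  show W.ρ n = 1
  have h1 : W.ρ n * ∑ n : V.repKer, W.ρ n = ∑ n : V.repKer, W.ρ n := by
    rw [Finset.mul_sum, ← Equiv.sum_comp (Equiv.mulLeft (⟨n, hn⟩ : V.repKer)) (fun n => W.ρ n)]
    refine Finset.sum_congr rfl fun m _ => ?_
    rw [← map_mul]; rfl
  rw [hr, mul_smul_comm, mul_one] at h1
  exact smul_right_injective _ hr0 h1

theorem stmt1 {G : Type} [Group G] [Fintype G] (p : ℕ) (hp : p.Prime)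
    (hdvd : p ∣ Fintype.card G)
    (φ₁ φ₂ : FDRep ℂ G) (h₁ : Simple φ₁) (h₂ : Simple φ₂)
    (hs₁ : φ₁.IsPSpecial p) (hs₂ : φ₂.IsPSpecial p)
    (hagree : ∀ g : G, ¬ p ∣ orderOf g → φ₁.character g = φ₂.character g) :
    Nonempty (φ₁ ≅ φ₂) ∧ φ₁.character = φ₂.character := by
  classical
  obtain ⟨a, u, hu, hau⟩ := Nat.exists_eq_pow_mul_and_not_dvd (n := Fintype.card G)
    Fintype.card_ne_zero p hp.ne_one
  have hcop : Nat.Coprime (p ^ a) u := ((Nat.Prime.coprime_iff_not_dvd hp).2 hu).pow_left a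
  obtain ⟨k, hk0, hk⟩ := Nat.chineseRemainder hcop 0 1
  have hreg : ∀ g : G, φ₁.character (g ^ k) = φ₂.character (g ^ k) := by
    intro g
    apply hagree
    intro hpd
    apply hu
    refine hpd.trans (orderOf_dvd_of_pow_eq_one ?_)
    obtain ⟨j, rfl⟩ := (Nat.modEq_zero_iff_dvd.1 hk0)
    rw [← pow_mul, mul_right_comm, ← hau, pow_mul, pow_card_eq_one, one_pow]
  have hker : φ₁.repKer = φ₂.repKer := le_antisymm
    (aux_ker_le p hp φ₁ φ₂ hs₂ a u k hau hk hreg)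
    (aux_ker_le p hp φ₂ φ₁ hs₁ a u k hau hk fun g => (hreg g).symm)
  have hchar : φ₁.character = φ₂.character := by
    funext g
    have e1 := aux_special_value p hp φ₁ hs₁ a u k hau hk g
    have e2 := aux_special_value p hp φ₂ hs₂ a u k hau hk g
    rw [← hker] at e2
    by_cases h : g⁻¹ * g ^ k ∈ φ₁.repKer
    · rw [e1.1 h, e2.1 h, hreg]
    · rw [e1.2 h, e2.2 h]
  refine ⟨?_, hchar⟩
  have : Invertible (Nat.card G : ℂ) := invertibleOfNonzero (by simp)
  have o1 := FDRep.char_orthonormal φ₁ φ₂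
  have o2 := FDRep.char_orthonormal φ₁ φ₁
  rw [if_pos ⟨Iso.refl _⟩] at o2
  rw [← hchar, o2] at o1
  by_contra hne
  rw [if_neg hne] at o1
  simp at o1
end

section
/- Let G be a finite group, p a prime, and let φ₁, φ₂ be irreducible complex representations of G with characters χ₁, χ₂ and kernels H₁ = ker(φ₁), H₂ = ker(φ₂). Suppose: (1) for each i ∈ {1,2}, χ_i(g) = 0 for every g ∈ G such that the order of the image of g in the quotient group G/H_i is divisible by p; and (2) χ₁(g) = χ₂(g) for every g ∈ G whose order is not divisible by p. Then χ₁ = χ₂, i.e., φ₁ and φ₂ are isomorphic. -/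
open CategoryTheory

open scoped ComplexOrder in
theorem aux_char_inv {G : Type} [Group G] [Fintype G] (V : FDRep ℂ G) (g : G) :
    V.character g⁻¹ = star (V.character g) := by
  classical
  let b := Module.finBasis ℂ V
  let M : G → Matrix _ _ ℂ := fun h => LinearMap.toMatrix b b (V.ρ h)
  have hM : ∀ x y, M (x * y) = M x * M y := by
    intro x y
    simp only [M, map_mul]
    exact LinearMap.toMatrix_mul b _ _
  have hM1 : M 1 = 1 := by
    simp only [M, map_one]
    exact LinearMap.toMatrix_one b
  have htr : ∀ x, V.character x = (M x).trace := fun x =>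
    LinearMap.trace_eq_matrix_trace ℂ b (V.ρ x)
  let P := ∑ h : G, (M h).conjTranspose * M h
  have hP : P.PosDef := by
    have : P = 1 + ∑ h ∈ Finset.univ.erase (1 : G), (M h).conjTranspose * M h := by
      simp only [P]
      rw [← Finset.add_sum_erase _ _ (Finset.mem_univ (1 : G)), hM1]
      simp
    rw [this]
    exact Matrix.PosDef.one.add_posSemidef
      (Matrix.posSemidef_sum _ fun i _ => Matrix.posSemidef_conjTranspose_mul_self _)
  have hinv : (M g).conjTranspose * P * M g = P := by
    simp only [P, Finset.mul_sum, Finset.sum_mul]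
    rw [← Equiv.sum_comp (Equiv.mulRight g) (fun h => (M h).conjTranspose * M h)]
    refine Finset.sum_congr rfl fun h _ => ?_
    simp [hM, Matrix.mul_assoc]
  have hgg : M g * M g⁻¹ = 1 := by rw [← hM, mul_inv_cancel, hM1]
  have h2 : (M g).conjTranspose * P = P * M g⁻¹ := by
    calc _ = (M g).conjTranspose * P * (M g * M g⁻¹) := by rw [hgg, mul_one]
      _ = _ := by rw [← mul_assoc, hinv]
  have hu : IsUnit P.det := (Matrix.isUnit_iff_isUnit_det _).1 hP.isUnit
  have h3 : M g⁻¹ = P⁻¹ * ((M g).conjTranspose * P) := by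
    rw [h2, ← mul_assoc, Matrix.nonsing_inv_mul _ hu, one_mul]
  rw [htr, htr, h3, Matrix.trace_mul_comm, mul_assoc, Matrix.mul_nonsing_inv _ hu, mul_one,
    Matrix.trace_conjTranspose]

theorem aux_decomp {G : Type} [Group G] [Fintype G] (p : ℕ) (hp : p.Prime) (g : G) :
    ∃ s u : G, ∃ j a : ℕ, g = s * u ∧ ¬ p ∣ orderOf s ∧ u = g ^ j ∧ u ^ (p ^ a) = 1 := by
  obtain ⟨a, m, hm, hn⟩ := Nat.exists_eq_pow_mul_and_not_dvd (orderOf_pos g).ne' p hp.ne_one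
  have hc : Nat.Coprime (p ^ a) m := Nat.Coprime.pow_left _ ((hp.coprime_iff_not_dvd).2 hm)
  obtain ⟨k, hk1, hk2⟩ := Nat.chineseRemainder hc 0 1
  obtain ⟨j, hj1, hj2⟩ := Nat.chineseRemainder hc 1 0
  refine ⟨g ^ k, g ^ j, j, a, ?_, ?_, rfl, ?_⟩
  · rw [← pow_add]
    nth_rewrite 1 [← pow_one g]
    rw [pow_eq_pow_iff_modEq, hn]
    refine (Nat.modEq_and_modEq_iff_modEq_mul hc).1 ⟨?_, ?_⟩
    · exact (hk1.add hj1).symm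
    · exact (hk2.add hj2).symm
  · intro h
    apply hm
    refine h.trans (orderOf_dvd_of_pow_eq_one ?_)
    rw [← pow_mul, ← orderOf_dvd_iff_pow_eq_one, hn]
    exact mul_dvd_mul ((Nat.modEq_zero_iff_dvd).1 hk1) dvd_rfl
  · rw [← pow_mul, ← orderOf_dvd_iff_pow_eq_one, hn, mul_comm]
    exact mul_dvd_mul ((Nat.modEq_zero_iff_dvd).1 hj2) dvd_rfl

theorem aux_mem {G : Type} [Group G] [Fintype G] (p : ℕ) (hp : p.Prime) (N : Subgroup G)
    [N.Normal] (g u : G) (j a : ℕ) (hu : u = g ^ j) (hua : u ^ (p ^ a) = 1)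
    (h : ¬ p ∣ orderOf (g : G ⧸ N)) : u ∈ N := by
  rw [← QuotientGroup.eq_one_iff, ← orderOf_eq_one_iff]
  have h1 : orderOf (u : G ⧸ N) ∣ p ^ a := by
    apply orderOf_dvd_of_pow_eq_one
    rw [← QuotientGroup.mk_pow, hua, QuotientGroup.mk_one]
  have h2 : orderOf (u : G ⧸ N) ∣ orderOf (g : G ⧸ N) := by
    rw [hu, QuotientGroup.mk_pow]
    exact orderOf_pow_dvd j
  exact Nat.eq_one_of_dvd_coprimes (Nat.Coprime.pow_left a ((hp.coprime_iff_not_dvd).2 h)) h1 h2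

theorem aux_val {G : Type} [Group G] [Fintype G] (p : ℕ) (hp : p.Prime) (V : FDRep ℂ G)
    (hv : ∀ g : G, p ∣ orderOf ((g : G ⧸ V.repKer)) → V.character g = 0)
    (g s u : G) (j a : ℕ) (hg : g = s * u) (hu : u = g ^ j) (hua : u ^ (p ^ a) = 1) :
    V.character g = 0 ∨ V.character g = V.character s := by
  by_cases h : p ∣ orderOf ((g : G ⧸ V.repKer))
  · exact Or.inl (hv g h)
  · right
    have hm : V.ρ u = 1 := aux_mem p hp V.repKer g u j a hu hua h
    simp only [FDRep.character]
    rw [hg, map_mul, hm, mul_one]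

theorem aux_char_one {G : Type} [Group G] [Fintype G] (V : FDRep ℂ G) (h : Simple V) :
    V.character 1 ≠ 0 := by
  intro h0
  rw [FDRep.char_one, Nat.cast_eq_zero, Module.finrank_zero_iff] at h0
  have : Invertible (Nat.card G : ℂ) := invertibleOfNonzero (by simp)
  have h1 := FDRep.char_orthonormal V V
  have hz : ∀ g, V.character g = 0 := by
    intro g
    simp only [FDRep.character]
    rw [Subsingleton.elim (V.ρ g) 0, map_zero]
  rw [if_pos ⟨Iso.refl V⟩] at h1
  simp [hz] at h1

theorem stmt2 {G : Type} [Group G] [Fintype G] (p : ℕ) (hp : p.Prime)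
    (φ₁ φ₂ : FDRep ℂ G) (h₁ : Simple φ₁) (h₂ : Simple φ₂)
    (hvanish₁ : ∀ g : G, p ∣ orderOf ((g : G ⧸ φ₁.repKer)) → φ₁.character g = 0)
    (hvanish₂ : ∀ g : G, p ∣ orderOf ((g : G ⧸ φ₂.repKer)) → φ₂.character g = 0)
    (hagree : ∀ g : G, ¬ p ∣ orderOf g → φ₁.character g = φ₂.character g) :
    φ₁.character = φ₂.character ∧ Nonempty (φ₁ ≅ φ₂) := by
  have hinv : Invertible (Nat.card G : ℂ) := invertibleOfNonzero (by simp)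
  suffices hN : Nonempty (φ₁ ≅ φ₂) from ⟨FDRep.char_iso hN.some, hN⟩
  by_contra hN
  have h := FDRep.char_orthonormal φ₁ φ₂
  rw [if_neg hN, mul_eq_zero] at h
  have hS : ∑ g : G, φ₁.character g * φ₂.character g⁻¹ = 0 := by
    rcases h with h | h
    · simp at h
    · exact h
  have hnn : ∀ g : G, 0 ≤ (φ₁.character g * φ₂.character g⁻¹).re := by
    intro g
    obtain ⟨s, u, j, a, hg, hs, hu, hua⟩ := aux_decomp p hp g
    rw [aux_char_inv]
    rcases aux_val p hp φ₁ hvanish₁ g s u j a hg hu hua with e1 | e1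
    · simp [e1]
    rcases aux_val p hp φ₂ hvanish₂ g s u j a hg hu hua with e2 | e2
    · simp [e2]
    rw [e1, e2, ← hagree s hs, Complex.star_def, Complex.mul_conj, Complex.ofReal_re]
    exact Complex.normSq_nonneg _
  have hre : ∑ g : G, (φ₁.character g * φ₂.character g⁻¹).re = 0 := by
    rw [← Complex.re_sum, hS, Complex.zero_re]
  have h1 := (Finset.sum_eq_zero_iff_of_nonneg fun g _ => hnn g).1 hre 1 (Finset.mem_univ _)
  rw [aux_char_inv, ← hagree 1 (by simpa using hp.one_lt.ne'), Complex.star_def, Complex.mul_conj,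
    Complex.ofReal_re, Complex.normSq_eq_zero] at h1
  exact aux_char_one φ₁ h₁ h1
end

section
/- Let G be a finite group, p a prime dividing the order of G, and let φ be a p-special irreducible complex representation of G with character χ and kernel H = ker(φ). Then χ(g) = 0 for every g ∈ G such that the order of the image of g in the quotient group G/H is divisible by p. -/
open CategoryTheory

namespace PSpec

/-- Sum of a function invariant under a permutation of order dividing `p ^ n`. -/
lemma sum_perm_dvd {X A : Type*} [Fintype X] [CommRing A] (p n m : ℕ) (hp : p.Prime)
    (σ : Equiv.Perm X) (hσ : σ ^ (p ^ n) = 1) (F : X → A) (hF : ∀ x, F (σ x) = F x)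
    (h0 : ∀ x, (σ ^ (p ^ m)) x = x → F x = 0) : (p : A) ^ m ∣ ∑ x, F x := by
  classical
  let H := Subgroup.zpowers σ
  have hinv : ∀ (h : H) (x : X), F (h • x) = F x := by
    rintro ⟨h, hh⟩ x
    obtain ⟨k, rfl⟩ := Subgroup.mem_zpowers_iff.mp hh
    change F ((σ ^ k) x) = F x
    clear hh
    induction k using Int.induction_on generalizing x with
    | zero => simp
    | succ i ih =>
      rw [zpow_add_one, Equiv.Perm.mul_apply, ih , hF]
    | pred i ih =>
      rw [zpow_sub_one, Equiv.Perm.mul_apply, ih, ← hF (σ⁻¹ x)]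
      simp
  rw [← Finset.sum_fiberwise Finset.univ (fun x => (Quotient.mk (MulAction.orbitRel H X) x))]
  refine Finset.dvd_sum fun o _ => ?_
  induction o using Quotient.inductionOn with
  | h x =>
  have hmem : ∀ y, (Quotient.mk (MulAction.orbitRel H X) y = Quotient.mk (MulAction.orbitRel H X) x)
      ↔ y ∈ MulAction.orbit H x := by
    intro y
    rw [Quotient.eq]
    exact MulAction.orbitRel_apply
  rw [Finset.sum_congr rfl (g := fun _ => F x)]
  · rw [Finset.sum_const, nsmul_eq_mul]
    have hcard : (Finset.univ.filter fun y => Quotient.mk (MulAction.orbitRel H X) y = Quotient.mk (MulAction.orbitRel H X) x).card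
        = Function.minimalPeriod (σ • ·) x := by
      rw [MulAction.minimalPeriod_eq_card, Fintype.card_subtype]
      congr 1
      ext y
      simp [hmem]
      rfl
    rw [hcard]
    have hdvd : Function.minimalPeriod (σ • ·) x ∣ p ^ n := by
      apply Function.IsPeriodicPt.minimalPeriod_dvd
      change (fun y => σ • y)^[p ^ n] x = x
      rw [smul_iterate, hσ]
      simp
    obtain ⟨k, hk, hk'⟩ := (Nat.dvd_prime_pow hp).mp hdvd
    rw [hk']
    by_cases hkm : k ≤ m
    · rw [h0 x]
      · simp
      · have : Function.IsPeriodicPt (fun y => σ • y) (p ^ m) x := by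
          apply (Function.isPeriodicPt_iff_minimalPeriod_dvd).mpr
          rw [hk']
          exact pow_dvd_pow _ hkm
        have h2 : (fun y => σ • y)^[p ^ m] x = x := this
        rw [smul_iterate] at h2
        exact h2
    · push_cast
      exact Dvd.dvd.mul_right (pow_dvd_pow _ (by omega)) _
  · intro y hy
    rw [Finset.mem_filter, hmem] at hy
    obtain ⟨h, rfl⟩ := hy.2
    exact hinv h x

/-- Rotation of words. -/
def rot (Q : Type*) (N : ℕ) [NeZero N] : Equiv.Perm (Fin N → Q) :=
  (Equiv.addRight (1 : Fin N)).symm.arrowCongr (Equiv.refl Q)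

lemma rot_apply {Q : Type*} {N : ℕ} [NeZero N] (w : Fin N → Q) (i : Fin N) :
    rot Q N w i = w (i + 1) := rfl

open scoped Fin.NatCast in
lemma rot_pow_apply {Q : Type*} {N : ℕ} [NeZero N] (d : ℕ) (w : Fin N → Q) (i : Fin N) :
    (rot Q N ^ d) w i = w (i + (d : Fin N)) := by
  induction d generalizing w i with
  | zero => simp
  | succ d ih =>
    rw [pow_succ, Equiv.Perm.mul_apply, ih, rot_apply]
    push_cast
    rw [add_assoc]

open scoped Fin.NatCast in
lemma rot_pow_self (Q : Type*) (N : ℕ) [NeZero N] : rot Q N ^ N = 1 := by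
  ext w i
  rw [rot_pow_apply]
  simp

lemma prod_rot {Q : Type*} [Group Q] {N : ℕ} [NeZero N] (w : Fin N → Q) :
    (List.ofFn (rot Q N w)).prod = (w 0)⁻¹ * (List.ofFn w).prod * w 0 := by
  obtain ⟨n, rfl⟩ := Nat.exists_eq_succ_of_ne_zero (NeZero.ne N)
  rw [List.ofFn_succ', List.ofFn_succ (f := w)]
  simp [rot_apply, List.concat_eq_append, Fin.coeSucc_eq_succ]

open scoped Fin.NatCast in
lemma prod_periodic {Q : Type*} [Group Q] (d e : ℕ) [NeZero (d * e)] (w : Fin (d * e) → Q)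
    (h : (rot Q (d * e) ^ d) w = w) : ∃ v : Q, (List.ofFn w).prod = v ^ e := by
  let u : ℕ → Q := fun i => w (i : Fin (d * e))
  have hu : ∀ i, u (d + i) = u i := by
    intro i
    have := congrFun h (i : Fin (d * e))
    rw [rot_pow_apply] at this
    simp only [u]
    rw [← this]
    push_cast
    rw [add_comm]
  have hw : List.ofFn w = (List.range (d * e)).map u := by
    apply List.ext_getElem
    · simp
    · intro i h1 h2
      simp only [List.getElem_ofFn, List.getElem_map, List.getElem_range, u]
      congr 1
      ext
      simp at h1
      simp [Fin.val_natCast, Nat.mod_eq_of_lt h1]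
  have key : ∀ k, ((List.range (d * k)).map u).prod = ((List.range d).map u).prod ^ k := by
    intro k
    induction k with
    | zero => simp
    | succ k ih =>
      rw [show d * (k + 1) = d + d * k by ring, List.range_add, List.map_append, List.prod_append,
        List.map_map, pow_succ', ← ih]
      congr 3
      ext i
      exact hu i
  exact ⟨_, by rw [hw, key e]⟩

lemma sum_words {Q A : Type*} [Group Q] [Fintype Q] [CommRing A] (a f : Q → A) (c : A)
    (conv : ∀ s, ∑ q, a q * a (q⁻¹ * s) = c * a s) (k : ℕ) (h : Q) :
    ∑ w : Fin (k + 1) → Q, (∏ i, a (w i)) * f (h * (List.ofFn w).prod)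
      = c ^ k * ∑ q, a q * f (h * q) := by
  induction k generalizing h with
  | zero =>
    rw [← (Equiv.funUnique (Fin 1) Q).symm.sum_comp]
    simp
  | succ k ih =>
    rw [← (Fin.consEquiv (fun _ => Q)).sum_comp, Fintype.sum_prod_type]
    have : ∀ q, ∑ w : Fin (k + 1) → Q, (∏ i, a ((Fin.consEquiv (fun _ => Q)) (q, w) i)) *
        f (h * (List.ofFn ((Fin.consEquiv (fun _ => Q)) (q, w))).prod)
        = c ^ k * ∑ s, f (h * s) * (a q * a (q⁻¹ * s)) := by
      intro q
      have := ih (h * q)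
      rw [← Equiv.sum_comp (Equiv.mulLeft q⁻¹) (fun s => a s * f (h * q * s))] at this
      simp only [Equiv.coe_mulLeft, mul_assoc, mul_inv_cancel_left] at this
      calc _ = a q * ∑ w : Fin (k + 1) → Q, (∏ i, a (w i)) * f (h * (q * (List.ofFn w).prod)) := by
            rw [Finset.mul_sum]
            refine Finset.sum_congr rfl fun w _ => ?_
            rw [Fin.prod_univ_succ, List.ofFn_succ]
            simp [Fin.consEquiv, mul_assoc]
        _ = _ := by
            rw [this, mul_left_comm, Finset.mul_sum]
            congr 1
            refine Finset.sum_congr rfl fun w _ => by ring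
    rw [Finset.sum_congr rfl fun q _ => this q, ← Finset.mul_sum, Finset.sum_comm]
    simp only [← Finset.mul_sum, conv]
    rw [pow_succ, mul_assoc, Finset.mul_sum (a := c)]
    congr 1
    refine Finset.sum_congr rfl fun w _ => by ring

lemma main_div {Q A : Type*} [Group Q] [Fintype Q] [CommRing A] (p : ℕ) (hp : p.Prime)
    (a f : Q → A) (c : ℕ) (hc : ¬ p ∣ c)
    (conv : ∀ s, ∑ q, a q * a (q⁻¹ * s) = c * a s)
    (hf : ∀ q r, f (r⁻¹ * q * r) = f q) (hf0 : ∀ q, ¬ p ∣ orderOf q → f q = 0) (m : ℕ) :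
    (p : A) ^ m ∣ ∑ q, a q * f q := by
  obtain ⟨t, r, hr, hcard⟩ := Nat.exists_eq_pow_mul_and_not_dvd
    (n := Fintype.card Q) Fintype.card_ne_zero p hp.ne_one
  have hreg : ∀ v : Q, ¬ p ∣ orderOf (v ^ p ^ t) := by
    intro v hv
    apply hr
    refine hv.trans (orderOf_dvd_of_pow_eq_one ?_)
    rw [← pow_mul, ← hcard, pow_card_eq_one]
  obtain ⟨k, hk⟩ : ∃ k, p ^ m * p ^ t = k + 1 :=
    Nat.exists_eq_succ_of_ne_zero (by have := hp.pos; positivity)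
  have : NeZero (p ^ m * p ^ t) := ⟨by have := hp.pos; positivity⟩
  have h1 : (p : A) ^ m ∣ ∑ w : Fin (p ^ m * p ^ t) → Q, (∏ i, a (w i)) * f ((List.ofFn w).prod) := by
    apply sum_perm_dvd p (m + t) m hp (rot Q _)
    · rw [pow_add]; exact rot_pow_self _ _
    · intro w
      rw [prod_rot, hf]
      congr 1
      exact Equiv.prod_comp (Equiv.addRight (1 : Fin (p ^ m * p ^ t))) (fun i => a (w i))
    · intro w hw
      obtain ⟨v, hv⟩ := prod_periodic _ _ w hw
      rw [hv, hf0 _ (hreg v), mul_zero]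
  have h2 := sum_words a f c conv k 1
  simp only [one_mul] at h2
  rw [hk, h2] at h1
  have hcop : IsCoprime ((p : A) ^ m) ((c : A) ^ k) := by
    apply IsCoprime.pow
    have : IsCoprime (p : ℤ) (c : ℤ) := Nat.isCoprime_iff_coprime.mpr
      ((Nat.Prime.coprime_iff_not_dvd hp).mpr hc)
    simpa using this.map (Int.castRingHom A)
  exact hcop.dvd_of_dvd_mul_left h1

lemma eq_zero_of_div (p : ℕ) (hp : p.Prime) (y : ℂ)
    (h : ∀ m : ℕ, ∃ z, IsIntegral ℤ z ∧ y = (p : ℂ) ^ m * z) : y = 0 := by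
  by_contra hy
  have hyi : IsIntegral ℤ y := by
    obtain ⟨z, hz, h⟩ := h 0
    simpa [h] using hz
  have hyq : IsIntegral ℚ y := hyi.tower_top
  let K := IntermediateField.adjoin ℚ {y}
  have : FiniteDimensional ℚ K := IntermediateField.adjoin.finiteDimensional hyq
  have : NumberField K := ⟨⟩
  have hp0 : (p : ℂ) ≠ 0 := by exact_mod_cast hp.ne_zero
  have hK : ∀ z : K, IsIntegral ℤ (z : ℂ) → IsIntegral ℤ z := by
    intro z hz
    exact (isIntegral_algebraMap_iff (algebraMap K ℂ).injective).mp hz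
  let Y : K := ⟨y, IntermediateField.mem_adjoin_simple_self ℚ y⟩
  let Y' : NumberField.RingOfIntegers K := ⟨Y, hK Y hyi⟩
  have hY' : Y' ≠ 0 := by
    intro h0
    apply hy
    have := congrArg (fun t : NumberField.RingOfIntegers K => ((t : K) : ℂ)) h0
    exact this
  have hnu : ¬ IsUnit (p : NumberField.RingOfIntegers K) := by
    intro hu
    obtain ⟨b, hb⟩ := hu.exists_right_inv
    have hb' : (p : K) * (b : K) = 1 := by
      have := congrArg (fun t : NumberField.RingOfIntegers K => (t : K)) hb
      simpa using this
    have hpK : (p : K) ≠ 0 := by exact_mod_cast hp.ne_zero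
    have hbq : (b : K) = algebraMap ℚ K ((p : ℚ)⁻¹) := by
      rw [map_inv₀, map_natCast]; field_simp; rw [mul_comm]; exact hb'
    have hint : IsIntegral ℤ ((p : ℚ)⁻¹) := by
      rw [← isIntegral_algebraMap_iff (algebraMap ℚ K).injective, ← hbq]
      exact b.2
    obtain ⟨z, hz⟩ := IsIntegrallyClosed.isIntegral_iff.mp hint
    have hz' : (z : ℚ) * p = 1 := by
      have : (z : ℚ) = (p : ℚ)⁻¹ := by simpa using hz
      rw [this]; exact inv_mul_cancel₀ (by exact_mod_cast hp.ne_zero)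
    have hz2 : z * p = 1 := by exact_mod_cast hz'
    have := Int.isUnit_iff.mp (IsUnit.of_mul_eq_one_right _ hz2)
    have := hp.two_le
    omega
  have hfin := FiniteMultiplicity.of_not_isUnit hnu hY'
  obtain ⟨n, hn⟩ := hfin
  apply hn
  obtain ⟨z, hz, hyz⟩ := h (n + 1)
  have hzK : z ∈ K := by
    have : z = ((Y * ((p : K) ^ (n + 1))⁻¹ : K) : ℂ) := by
      push_cast
      simp only [Y]
      rw [hyz]; field_simp
    rw [this]; exact SetLike.coe_mem _
  let Z : NumberField.RingOfIntegers K := ⟨⟨z, hzK⟩, hK _ hz⟩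
  refine ⟨Z, ?_⟩
  apply NumberField.RingOfIntegers.ext
  apply Subtype.ext
  have e : algebraMap (NumberField.RingOfIntegers K) K
      ((p : NumberField.RingOfIntegers K) ^ (n + 1) * Z) = (p : K) ^ (n + 1) * ⟨z, hzK⟩ := by
    rw [map_mul, map_pow, map_natCast]
    rfl
  refine Eq.trans ?_ (congrArg (algebraMap K ℂ) e).symm
  rw [map_mul, map_pow, map_natCast]
  exact hyz

end PSpec

namespace PSpec
lemma schur {G : Type} [Group G] (V : FDRep ℂ G) [Simple V] (T : V →ₗ[ℂ] V)
    (hT : ∀ g, T * V.ρ g = V.ρ g * T) : ∃ c : ℂ, T = c • 1 := by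
  let f : V ⟶ V := ⟨InducedCategory.homMk (ModuleCat.ofHom T), fun g => by
    ext1
    ext1 x
    exact (LinearMap.congr_fun (hT g) x)⟩
  obtain ⟨c, hc⟩ := endomorphism_simple_eq_smul_id ℂ f
  refine ⟨c, ?_⟩
  have h : f.hom.hom.hom = T := rfl
  rw [← h, ← hc]
  rfl

lemma char_conv {G : Type} [Group G] [Fintype G] (V : FDRep ℂ G) [Simple V] :
    (Module.finrank ℂ V : ℂ) ≠ 0 ∧ ∀ s, ∑ g, V.character g * V.character (g⁻¹ * s) =
      ((Fintype.card G : ℂ) / Module.finrank ℂ V) * V.character s := by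
  classical
  have hG : (Fintype.card G : ℂ) ≠ 0 := by exact_mod_cast Fintype.card_ne_zero
  have : Invertible (Nat.card G : ℂ) := invertibleOfNonzero (by simp)
  have ho := FDRep.char_orthonormal V V
  rw [if_pos ⟨Iso.refl V⟩, Nat.card_eq_fintype_card, inv_mul_eq_iff_eq_mul₀ hG, mul_one] at ho
  let T : V →ₗ[ℂ] V := ∑ g, V.character g • V.ρ g⁻¹
  obtain ⟨c, hc⟩ := schur V T (by
    intro h
    simp only [T, Finset.sum_mul, Finset.mul_sum, smul_mul_assoc, mul_smul_comm, ← map_mul]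
    rw [← Equiv.sum_comp (MulAut.conj h).toEquiv]
    refine Finset.sum_congr rfl fun g _ => ?_
    simp only [MulEquiv.toEquiv_eq_coe, MulEquiv.coe_toEquiv, MulAut.conj_apply, FDRep.char_conj]
    congr 2
    group)
  have ht : ∀ s, ∑ g, V.character g * V.character (g⁻¹ * s) = c * V.character s := by
    intro s
    have h1 : LinearMap.trace ℂ V (T * V.ρ s) = c * V.character s := by
      rw [hc]; simp [FDRep.character]
    rw [← h1]
    simp [T, Finset.sum_mul, ← map_mul, FDRep.character]
  have h1 := ht 1
  simp only [mul_one, FDRep.char_one] at h1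
  rw [ho] at h1
  have hn : (Module.finrank ℂ V : ℂ) ≠ 0 := by
    intro h0; rw [h0] at h1; simp at h1
  refine ⟨hn, fun s => ?_⟩
  rw [ht, h1]
  field_simp

lemma char_integral {G : Type} [Group G] [Fintype G] (V : FDRep ℂ G) (g : G) :
    IsIntegral ℤ (V.character g) := by
  have : V.character g = (V.ρ g).charpoly.roots.sum :=
    Module.End.trace_eq_sum_roots_charpoly_of_splits (IsAlgClosed.splits _)
  rw [this]
  apply IsIntegral.multiset_sum
  intro μ hμ
  have hev : Module.End.HasEigenvalue (V.ρ g) μ := by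
    rw [Module.End.hasEigenvalue_iff_isRoot_charpoly]
    exact Polynomial.isRoot_of_mem_roots hμ
  obtain ⟨v, hv⟩ := hev.exists_hasEigenvector
  have h1 := hv.pow_apply (Fintype.card G)
  rw [← map_pow, pow_card_eq_one, map_one] at h1
  have h2 : μ ^ Fintype.card G = 1 := by
    have h3 : (1 - μ ^ Fintype.card G) • v = 0 := by
      rw [sub_smul, ← h1]; simp
    rcases smul_eq_zero.mp h3 with h | h
    · linear_combination -h
    · exact absurd h hv.2
  apply IsIntegral.of_pow (n := Fintype.card G) Fintype.card_pos
  rw [h2]; exact isIntegral_one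

lemma sum_quot {G A : Type*} [Group G] [Fintype G] [CommRing A] (H : Subgroup G) [Fintype (G ⧸ H)]
    (F : G ⧸ H → A) :
    ∑ g : G, F (g : G ⧸ H) = (Nat.card H : A) * ∑ q, F q := by
  classical
  have : Fintype H := Fintype.ofFinite _
  let e : (G ⧸ H) × H → G := fun x => x.1.out * x.2
  have he : ∀ x, ((e x : G) : G ⧸ H) = x.1 := by
    rintro ⟨q, h⟩
    change ((q.out * h : G) : G ⧸ H) = q
    rw [QuotientGroup.mk_mul_of_mem _ h.2]
    exact Quotient.out_eq' q
  have hb : Function.Bijective e := by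
    constructor
    · rintro ⟨q, h⟩ ⟨q', h'⟩ hh
      have h1 : q = q' := by
        have := he (q, h)
        rw [hh, he] at this
        exact this.symm
      subst h1
      have : (h : G) = h' := mul_left_cancel hh
      rw [Subtype.ext this]
    · intro g
      refine ⟨((g : G ⧸ H), ⟨(g : G ⧸ H).out⁻¹ * g, ?_⟩), ?_⟩
      · rw [← QuotientGroup.eq]
        exact Quotient.out_eq' _
      · simp [e]
  rw [← Equiv.sum_comp (Equiv.ofBijective e hb), Fintype.sum_prod_type, Finset.mul_sum]
  refine Finset.sum_congr rfl fun q _ => ?_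
  simp [he]

lemma c_integral {Q : Type*} [Group Q] [Fintype Q] (X : Q → ℂ) (hX : ∀ q, IsIntegral ℤ (X q))
    (hX1 : X 1 ≠ 0) (c : ℂ) (conv : ∀ s, ∑ q, X q * X (q⁻¹ * s) = c * X s) : IsIntegral ℤ c := by
  let A := integralClosure ℤ ℂ
  let N : Submodule A ℂ := Submodule.span A (Set.range X)
  have h : IsIntegral A c := by
    apply isIntegral_of_smul_mem_submodule N
    · intro h
      apply hX1
      have : X 1 ∈ N := Submodule.subset_span ⟨1, rfl⟩
      rw [h] at this
      simpa using this
    · exact Submodule.fg_span (Set.finite_range X)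
    · intro n hn
      induction hn using Submodule.span_induction with
      | mem x hx =>
        obtain ⟨s, rfl⟩ := hx
        rw [smul_eq_mul, ← conv]
        refine Submodule.sum_mem _ fun q _ => ?_
        exact N.smul_mem (⟨X q, hX q⟩ : A) (Submodule.subset_span ⟨_, rfl⟩)
      | zero => simp
      | add x y _ _ hx hy => rw [smul_add]; exact N.add_mem hx hy
      | smul a x _ hx => rw [smul_comm]; exact N.smul_mem a hx
  exact isIntegral_trans c h
end PSpec

theorem stmt4 {G : Type} [Group G] [Fintype G] (p : ℕ) (hp : p.Prime)
    (hdvd : p ∣ Fintype.card G)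
    (φ : FDRep ℂ G) (hsimple : Simple φ) (hspecial : φ.IsPSpecial p) :
    ∀ g : G, p ∣ orderOf ((g : G ⧸ φ.repKer)) → φ.character g = 0 := by
  intro g hg
  classical
  have := hsimple
  obtain ⟨hn, hconv⟩ := PSpec.char_conv φ
  set H := φ.repKer with hH
  let Q := G ⧸ H
  have : Fintype Q := Fintype.ofFinite _
  have hwd : ∀ x y : G, (x : Q) = (y : Q) → φ.character x = φ.character y := by
    intro x y hxy
    have h1 : φ.ρ (x⁻¹ * y) = 1 := QuotientGroup.eq.mp hxy
    have h2 : φ.ρ y = φ.ρ x := by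
      rw [show y = x * (x⁻¹ * y) by group, map_mul, h1, mul_one]
    rw [FDRep.character, FDRep.character, h2]
  let X : Q → ℂ := fun q => φ.character q.out
  have hX : ∀ x : G, X (x : Q) = φ.character x := fun x => hwd _ _ (Quotient.out_eq' _)
  have hHc : (Nat.card H : ℂ) ≠ 0 := by exact_mod_cast Nat.card_pos.ne'
  have hXint : ∀ q, IsIntegral ℤ (X q) := fun q => PSpec.char_integral φ _
  have hQconv : ∀ s, ∑ q, X q * X (q⁻¹ * s) =
      ((Fintype.card G : ℂ) / (Nat.card H * Module.finrank ℂ φ)) * X s := by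
    intro s
    induction s using QuotientGroup.induction_on with
    | H s =>
    have h1 := PSpec.sum_quot H (fun q : Q => X q * X (q⁻¹ * (s : Q)))
    have h2 : ∀ x : G, X (x : Q) * X ((x : Q)⁻¹ * (s : Q)) =
        φ.character x * φ.character (x⁻¹ * s) := by
      intro x
      rw [← QuotientGroup.mk_inv, ← QuotientGroup.mk_mul, hX, hX]
    rw [Finset.sum_congr rfl fun x _ => h2 x, hconv] at h1
    rw [hX]
    field_simp at h1 ⊢
    linear_combination -h1
  have hX1 : X 1 ≠ 0 := by
    have := hX 1
    rw [QuotientGroup.mk_one] at this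
    rw [this, FDRep.char_one]
    exact hn
  have hcint := PSpec.c_integral X hXint hX1 _ hQconv
  have hdv : (Nat.card H * Module.finrank ℂ φ) ∣ Fintype.card G := by
    have hcq : IsIntegral ℤ ((Fintype.card G : ℚ) / ((Nat.card H * Module.finrank ℂ φ : ℕ) : ℚ)) := by
      rw [← isIntegral_algebraMap_iff (algebraMap ℚ ℂ).injective]
      simpa using hcint
    obtain ⟨z, hz⟩ := IsIntegrallyClosed.isIntegral_iff.mp hcq
    have hne : ((Nat.card H * Module.finrank ℂ φ : ℕ) : ℚ) ≠ 0 := by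
      have : ((Nat.card H * Module.finrank ℂ φ : ℕ) : ℂ) ≠ 0 := by
        push_cast; exact mul_ne_zero hHc hn
      exact_mod_cast this
    have hz' : (z : ℚ) = (Fintype.card G : ℚ) / ((Nat.card H * Module.finrank ℂ φ : ℕ) : ℚ) := by
      simpa using hz
    rw [eq_div_iff hne] at hz'
    have hz2 : z * ((Nat.card H * Module.finrank ℂ φ : ℕ) : ℤ) = (Fintype.card G : ℤ) := by
      exact_mod_cast hz'
    exact Int.natCast_dvd_natCast.mp (Dvd.intro_left _ hz2)
  have hom : ((φ.omega : ℕ) : ℂ) = (Fintype.card G : ℂ) / (Nat.card H * Module.finrank ℂ φ) := by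
    rw [FDRep.omega, Nat.cast_div hdv]
    · push_cast; rfl
    · push_cast; exact mul_ne_zero hHc hn
  let a : Q → integralClosure ℤ ℂ := fun q => ⟨X q, hXint q⟩
  let f : Q → integralClosure ℤ ℂ := fun q => if IsConj q (g : Q) then 1 else 0
  have hsum : ∑ q, X q * (f q : ℂ) = (Finset.univ.filter fun q : Q => IsConj q (g : Q)).card * X (g : Q) := by
    rw [← nsmul_eq_mul, ← Finset.sum_const, Finset.sum_filter]
    refine Finset.sum_congr rfl fun q _ => ?_
    by_cases hq : IsConj q (g : Q)
    · simp only [f, if_pos hq]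
      obtain ⟨r, hr⟩ := isConj_iff.mp hq
      rw [← hr]
      induction q using QuotientGroup.induction_on with
      | H q =>
      induction r using QuotientGroup.induction_on with
      | H r =>
      rw [← QuotientGroup.mk_inv, ← QuotientGroup.mk_mul, ← QuotientGroup.mk_mul, hX, hX,
        FDRep.char_conj]
      simp
    · simp only [f, if_neg hq]
      simp
  have hy : ∑ q, X q * (f q : ℂ) = 0 := by
    apply PSpec.eq_zero_of_div p hp
    intro m
    obtain ⟨z, hz⟩ := PSpec.main_div p hp a f φ.omega hspecial (by
      intro s
      apply Subtype.ext
      push_cast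
      rw [hom]
      exact hQconv s) (by
      intro q r
      have : IsConj (r⁻¹ * q * r) q := isConj_iff.mpr ⟨r, by group⟩
      have h2 : IsConj (r⁻¹ * q * r) (g : Q) ↔ IsConj q (g : Q) :=
        ⟨fun h => this.symm.trans h, fun h => this.trans h⟩
      simp only [f, h2]) (by
      intro q hq
      have : ¬ IsConj q (g : Q) := by
        intro hc
        apply hq
        obtain ⟨r, hr⟩ := isConj_iff.mp hc
        have h3 : orderOf (g : Q) = orderOf q := by
          rw [← hr]
          exact orderOf_injective (MulAut.conj r).toMonoidHom (MulAut.conj r).injective q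
        rw [← h3]; exact hg
      simp only [f, if_neg this]) m
    refine ⟨z, z.2, ?_⟩
    have := congrArg (Subtype.val) hz
    push_cast at this
    exact this
  rw [hsum] at hy
  rcases mul_eq_zero.mp hy with h | h
  · exfalso
    have h' : (Finset.univ.filter fun q : Q => IsConj q (g : Q)).card = 0 := by exact_mod_cast h
    rw [Finset.card_eq_zero] at h'
    have : (g : Q) ∈ (Finset.univ.filter fun q : Q => IsConj q (g : Q)) := by
      rw [Finset.mem_filter]
      exact ⟨Finset.mem_univ _, IsConj.refl _⟩
    rw [h'] at this
    simp at this
  · rw [← hX]; exact h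
end

section
/- There are exactly 3 isomorphism classes of simple modules over the group algebra F₃[SL(2, F₃)]; that is, there exist three pairwise non-isomorphic simple F₃[SL(2, F₃)]-modules, and every simple F₃[SL(2, F₃)]-module is isomorphic to one of them. -/
/-- The group algebra `F₃[SL(2, F₃)]`. -/
noncomputable abbrev F₃SL₂F₃ : Type :=
  MonoidAlgebra (ZMod 3) (Matrix.SpecialLinearGroup (Fin 2) (ZMod 3))

universe u

abbrev GG := Matrix.SpecialLinearGroup (Fin 2) (ZMod 3)
def gT : GG := ⟨!![1,1;0,1], by decide⟩
def gS : GG := ⟨!![0,-1;1,0], by decide⟩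

lemma wordsGen (a b c d : ZMod 3) (h : a * d - b * c = 1) : ∃ i j k : Fin 4, !![a,b;c,d] = (gT.1 ^ i.1 * gS.1 ^ j.1 * gT.1 ^ k.1) := by
  revert a b c d
  decide +kernel

lemma gen (g : GG) : g ∈ Submonoid.closure {gS, gT} := by
  obtain ⟨g, hg⟩ := g
  have e := Matrix.eta_fin_two g
  rw [Matrix.det_fin_two] at hg
  obtain ⟨i, j, k, h⟩ := wordsGen _ _ _ _ hg
  have hS : gS ∈ Submonoid.closure {gS, gT} := Submonoid.subset_closure (by simp)
  have hT : gT ∈ Submonoid.closure {gS, gT} := Submonoid.subset_closure (by simp)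
  have hm := mul_mem (mul_mem (pow_mem hT i.1) (pow_mem hS j.1)) (pow_mem hT k.1)
  have he : (⟨g, by rw [Matrix.det_fin_two]; exact hg⟩ : GG) = gT ^ i.1 * gS ^ j.1 * gT ^ k.1 := by
    apply Subtype.ext
    change g = _
    rw [e, h]; simp
  rw [← he] at hm
  exact hm

lemma key {U : Type*} [AddCommGroup U] [Module (ZMod 3) U] (t s : U →ₗ[ZMod 3] U)
    (h1 : ∀ x, t (t (t x)) = x) (h2 : ∀ x, s (s (s (s x))) = x)
    (h3 : ∀ x, t (s (s x)) = s (s (t x))) (h4 : ∀ x, s (t (s x)) = t (t (s (t (t x)))))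
    (hx : ∃ x : U, x ≠ 0) :
    ∃ y : U, y ≠ 0 ∧ t y = y ∧ (s y = y ∨ (s (s y) = -y ∧ t (s y) = y + s y) ∨
      (s (s y) = y ∧ y + s y + t (s y) + t (t (s y)) = 0)) := by
  have three : ∀ x : U, (3:ZMod 3) • x = 0 := fun x => by
    rw [show (3:ZMod 3) = 0 from rfl, zero_smul]
  obtain ⟨u, hu, htu⟩ : ∃ u : U, u ≠ 0 ∧ t u = u := by
    obtain ⟨x, hx⟩ := hx
    by_cases a : t x - x = 0
    · exact ⟨x, hx, sub_eq_zero.1 a⟩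
    by_cases b : t (t x - x) - (t x - x) = 0
    · exact ⟨_, a, sub_eq_zero.1 b⟩
    refine ⟨_, b, sub_eq_zero.1 ?_⟩
    simp only [map_sub, h1]
    linear_combination (norm := module) three (t x - t (t x))
  by_cases hz : u + s (s u) = 0
  · have hz' : s (s u) = -u := by linear_combination (norm := module) hz
    have e1 : s (t (s u)) = t (t (s u)) := by rw [h4, htu, htu]
    have e2 : s (t (t (s u))) = - t (s u) := by rw [← e1, ← h3, hz', map_neg, map_neg]
    by_cases hm : s u + t (s u) + t (t (s u)) = 0
    · refine ⟨u, hu, htu, .inr (.inl ⟨hz', ?_⟩)⟩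
      have := congrArg s hm
      simp only [map_add, e1, e2, hz', map_zero] at this
      linear_combination (norm := module) this - hm + three (t (s u))
    · refine ⟨_, hm, ?_, .inr (.inl ⟨?_, ?_⟩)⟩
      · simp only [map_add, h1]; abel
      · simp only [map_add, e1, e2, hz', map_neg]; abel
      · simp only [map_add, e1, e2, hz', map_neg, h1, htu]
        linear_combination (norm := module) - three (t (t (s u)))
  · obtain ⟨v, hv, htv, hzv⟩ : ∃ v : U, v ≠ 0 ∧ t v = v ∧ s (s v) = v :=
      ⟨_, hz, by rw [map_add, h3, htu], by simp only [map_add, h2]; abel⟩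
    have e1 : s (t (s v)) = t (t (s v)) := by rw [h4, htv, htv]
    have e2 : s (t (t (s v))) = t (s v) := by rw [← e1, ← h3, hzv]
    by_cases hm : v + s v + t (s v) + t (t (s v)) = 0
    · exact ⟨v, hv, htv, .inr (.inr ⟨hzv, hm⟩)⟩
    · refine ⟨_, hm, ?_, .inl ?_⟩
      · simp only [map_add, h1, htv]; abel
      · simp only [map_add, e1, e2, hzv]; abel

def rho1 : Representation (ZMod 3) GG (ZMod 3) := Representation.trivial (ZMod 3) GG (ZMod 3)

def rho2 : Representation (ZMod 3) GG (Fin 2 → ZMod 3) where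
  toFun g := Matrix.mulVecLin g.1
  map_one' := by simp; rfl
  map_mul' g h := by simp [Matrix.mulVecLin_mul]; rfl

/-- Matrix of `g` on quadratic forms, in the basis `x², xy, y²`. -/
def symSq (g : Matrix (Fin 2) (Fin 2) (ZMod 3)) : Matrix (Fin 3) (Fin 3) (ZMod 3) :=
  !![g 0 0 ^ 2, g 0 0 * g 0 1, g 0 1 ^ 2;
     2 * g 0 0 * g 1 0, g 0 0 * g 1 1 + g 0 1 * g 1 0, 2 * g 0 1 * g 1 1;
     g 1 0 ^ 2, g 1 0 * g 1 1, g 1 1 ^ 2]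

lemma symSq_one : symSq 1 = 1 := by decide

lemma symSq_mul (g h) : symSq (g * h) = symSq g * symSq h := by
  ext i j
  fin_cases i <;> fin_cases j <;>
    simp [symSq, Matrix.mul_apply, Fin.sum_univ_succ] <;> ring

def rho3 : Representation (ZMod 3) GG (Fin 3 → ZMod 3) where
  toFun g := Matrix.mulVecLin (symSq g.1)
  map_one' := by simp [symSq_one]; rfl
  map_mul' g h := by simp [symSq_mul, Matrix.mulVecLin_mul]; rfl

lemma rho2T (c : Fin 2 → ZMod 3) : rho2 gT c = ![c 0 + c 1, c 1] := by
  revert c; decide +kernel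
lemma rho2S (c : Fin 2 → ZMod 3) : rho2 gS c = ![-c 1, c 0] := by
  revert c; decide +kernel
lemma rho3T (c : Fin 3 → ZMod 3) : rho3 gT c = ![c 0 + c 1 + c 2, c 1 + 2 * c 2, c 2] := by
  revert c; decide +kernel
lemma rho3S (c : Fin 3 → ZMod 3) : rho3 gS c = ![c 2, - c 1, c 0] := by
  revert c; decide +kernel

lemma simple_of {V : Type} [AddCommGroup V] [Module (ZMod 3) V] [Nontrivial V]
    (ρ : Representation (ZMod 3) GG V)
    (h : ∀ W : Submodule (ZMod 3) V, (∀ g, ∀ v ∈ W, ρ g v ∈ W) → ∀ v ∈ W, v ≠ 0 → W = ⊤) :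
    IsSimpleModule F₃SL₂F₃ ρ.asModule := by
  have : Nontrivial ρ.asModule := inferInstanceAs (Nontrivial V)
  have : IsSimpleOrder (Submodule F₃SL₂F₃ ρ.asModule) := by
    refine { eq_bot_or_eq_top := fun N => ?_ }
    by_cases hN : N = ⊥
    · exact .inl hN
    right
    obtain ⟨v, hv, hv0⟩ := N.exists_mem_ne_zero_of_ne_bot hN
    have hW := h ((N.restrictScalars (ZMod 3)).map ρ.asModuleEquiv.toLinearMap) (by
      rintro g _ ⟨w, hw, rfl⟩
      refine ⟨MonoidAlgebra.single g (1 : ZMod 3) • w, N.smul_mem _ hw, ?_⟩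
      rw [Representation.single_smul, one_smul]
      rfl) (ρ.asModuleEquiv v) ⟨v, hv, rfl⟩ (by simpa using hv0)
    rw [eq_top_iff]
    intro x _
    have : ρ.asModuleEquiv x ∈ (⊤ : Submodule (ZMod 3) V) := trivial
    rw [← hW] at this
    obtain ⟨y, hy, e⟩ := this
    have := ρ.asModuleEquiv.injective e
    exact this ▸ hy
  exact {}

lemma simple1 : IsSimpleModule F₃SL₂F₃ rho1.asModule := by
  refine simple_of _ fun W _ v hv h0 => ?_
  rw [eq_top_iff]
  intro x _
  have := W.smul_mem (x * v⁻¹) hv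
  rwa [smul_eq_mul, mul_assoc, inv_mul_cancel₀ h0, mul_one] at this

lemma simple2 : IsSimpleModule F₃SL₂F₃ rho2.asModule := by
  refine simple_of _ fun W hW v hv h0 => ?_
  have key : ∀ a : ZMod 3, a ≠ 0 → ![a, 0] ∈ W → W = ⊤ := by
    intro a ha hm
    rw [eq_top_iff]
    intro x _
    have h1 := hW gS _ hm
    rw [rho2S] at h1
    have := W.add_mem (W.smul_mem (x 0 * a⁻¹) hm) (W.smul_mem (x 1 * a⁻¹) h1)
    convert this using 1
    ext i; fin_cases i <;> simp [mul_assoc, ha]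
  by_cases h1 : v 1 = 0
  · refine key (v 0) (fun h => h0 ?_) ?_
    · ext i; fin_cases i <;> simp [h, h1]
    · convert hv using 1
      ext i; fin_cases i <;> simp [h1]
  · refine key (v 1) h1 ?_
    have := W.sub_mem (hW gT _ hv) hv
    rw [rho2T] at this
    convert this using 1
    ext i; fin_cases i <;> simp

lemma simple3 : IsSimpleModule F₃SL₂F₃ rho3.asModule := by
  refine simple_of _ fun W hW v hv h0 => ?_
  have key : ∀ a : ZMod 3, a ≠ 0 → ![a, 0, 0] ∈ W → W = ⊤ := by
    intro a ha hm
    rw [eq_top_iff]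
    intro x _
    have h1 := hW gS _ hm
    have h2 := hW gT _ h1
    rw [rho3S] at h1 h2
    rw [rho3T] at h2
    have := W.add_mem (W.add_mem (W.smul_mem ((x 0 + x 1) * a⁻¹) hm)
      (W.smul_mem ((x 2 + x 1) * a⁻¹) h1)) (W.smul_mem (-x 1 * a⁻¹) h2)
    convert this using 1
    have h3 : (2 : ZMod 3) = -1 := rfl
    ext i; fin_cases i <;> simp [mul_assoc, ha, h3]
  have key2 : ∀ a b : ZMod 3, b ≠ 0 → ![a, b, 0] ∈ W → W = ⊤ := by
    intro a b hb hm
    refine key b hb ?_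
    have := W.sub_mem (hW gT _ hm) hm
    rw [rho3T] at this
    convert this using 1
    ext i; fin_cases i <;> simp
  by_cases h2 : v 2 = 0
  · by_cases h1 : v 1 = 0
    · refine key (v 0) (fun h => h0 ?_) ?_
      · ext i; fin_cases i <;> simp [h, h1, h2]
      · convert hv using 1
        ext i; fin_cases i <;> simp [h1, h2]
    · refine key2 (v 0) (v 1) h1 ?_
      convert hv using 1
      ext i; fin_cases i <;> simp [h2]
  · refine key2 (v 1 + v 2) (2 * v 2) (mul_ne_zero (by decide) h2) ?_
    have := W.sub_mem (hW gT _ hv) hv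
    rw [rho3T] at this
    convert this using 1
    ext i; fin_cases i <;> simp [add_assoc]

lemma iso_of {V : Type} [AddCommGroup V] [Module (ZMod 3) V]
    (ρ : Representation (ZMod 3) GG V) [IsSimpleModule F₃SL₂F₃ ρ.asModule]
    {U : Type*} [AddCommGroup U] [Module (ZMod 3) U] [Module F₃SL₂F₃ U]
    [IsScalarTower (ZMod 3) F₃SL₂F₃ U] [IsSimpleModule F₃SL₂F₃ U]
    (σ : Representation (ZMod 3) GG U)
    (hσ : ∀ g x, σ g x = MonoidAlgebra.single g (1 : ZMod 3) • x)
    (f : V →ₗ[ZMod 3] U) (hT : ∀ v, f (ρ gT v) = σ gT (f v))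
    (hS : ∀ v, f (ρ gS v) = σ gS (f v)) (hf : ∃ v, f v ≠ 0) :
    Nonempty (U ≃ₗ[F₃SL₂F₃] ρ.asModule) := by
  have hg : ∀ g v, f (ρ g v) = σ g (f v) := by
    intro g
    induction gen g using Submonoid.closure_induction with
    | mem x hx =>
      rcases hx with rfl | rfl
      · exact hS
      · exact hT
    | one => simp
    | mul x y _ _ hx hy => intro v; simp [hx, hy]
  let F : ρ.asModule →ₗ[F₃SL₂F₃] U :=
    MonoidAlgebra.equivariantOfLinearOfComm (f.comp ρ.asModuleEquiv.toLinearMap) (by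
      intro g v
      rw [Representation.single_smul, one_smul, ← hσ]
      exact hg g _)
  have hF : F ≠ 0 := by
    obtain ⟨v, hv⟩ := hf
    intro h
    apply hv
    have := LinearMap.congr_fun h (ρ.asModuleEquiv.symm v)
    simpa [F] using this
  exact ⟨(LinearEquiv.ofBijective F (LinearMap.bijective_of_ne_zero hF)).symm⟩

lemma classify (U : Type*) [AddCommGroup U] [Module F₃SL₂F₃ U] [IsSimpleModule F₃SL₂F₃ U] :
    Nonempty (U ≃ₗ[F₃SL₂F₃] rho1.asModule) ∨ Nonempty (U ≃ₗ[F₃SL₂F₃] rho2.asModule) ∨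
      Nonempty (U ≃ₗ[F₃SL₂F₃] rho3.asModule) := by
  letI : Module (ZMod 3) U := Module.compHom U (algebraMap (ZMod 3) F₃SL₂F₃)
  have : IsScalarTower (ZMod 3) F₃SL₂F₃ U := by
    refine ⟨fun a b x => ?_⟩
    rw [Algebra.smul_def, mul_smul]; rfl
  have := simple1
  have := simple2
  have := simple3
  let σ : Representation (ZMod 3) GG U := Representation.ofModule' U
  have hσ : ∀ g x, σ g x = MonoidAlgebra.single g (1 : ZMod 3) • x := by
    intro g x
    simp [σ, Representation.ofModule']
  have : Nontrivial U := IsSimpleModule.nontrivial F₃SL₂F₃ U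
  have rel : ∀ {g h : GG}, g = h → ∀ x, σ g x = σ h x := fun h x => by rw [h]
  obtain ⟨y, hy, ht, hs⟩ := key (σ gT) (σ gS)
    (fun x => by simpa using rel (show gT * gT * gT = 1 by decide) x)
    (fun x => by simpa using rel (show gS * gS * gS * gS = 1 by decide) x)
    (fun x => by simpa using rel (show gT * gS * gS = gS * gS * gT by decide) x)
    (fun x => by simpa using rel (show gS * gT * gS = gT * gT * gS * gT * gT by decide) x)
    (exists_ne 0)
  have three : ∀ x : U, (3:ZMod 3) • x = 0 := fun x => by
    rw [show (3:ZMod 3) = 0 from rfl, zero_smul]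
  rcases hs with hs | ⟨hz, hs⟩ | ⟨hz, hs⟩
  · left
    refine iso_of rho1 σ hσ (LinearMap.toSpanSingleton (ZMod 3) U y) ?_ ?_ ⟨1, by simpa using hy⟩
    · intro v; simp [rho1, ht]
    · intro v; simp [rho1, hs]
  · right; left
    let f : (Fin 2 → ZMod 3) →ₗ[ZMod 3] U :=
      (LinearMap.proj 0).smulRight y + (LinearMap.proj 1).smulRight (σ gS y)
    have hf : ∀ c, f c = c 0 • y + c 1 • σ gS y := fun c => rfl
    refine iso_of rho2 σ hσ f ?_ ?_ ⟨![1, 0], by simpa [hf] using hy⟩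
    · intro v
      rw [hf, hf, rho2T]
      simp only [map_add, map_smul, ht, hs, Matrix.cons_val_zero, Matrix.cons_val_one]
      module
    · intro v
      rw [hf, hf, rho2S]
      simp only [map_add, map_smul, hz, Matrix.cons_val_zero, Matrix.cons_val_one]
      module
  · right; right
    let f : (Fin 3 → ZMod 3) →ₗ[ZMod 3] U :=
      (LinearMap.proj 0).smulRight y
        + (LinearMap.proj 1).smulRight (y + σ gS y - σ gT (σ gS y))
        + (LinearMap.proj 2).smulRight (σ gS y)
    have hf : ∀ c, f c = c 0 • y + c 1 • (y + σ gS y - σ gT (σ gS y)) + c 2 • σ gS y :=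
      fun c => rfl
    have e0 : σ gT (σ gT (σ gS y)) = - y - σ gS y - σ gT (σ gS y) := by
      linear_combination (norm := module) hs
    have e1 : σ gS (σ gT (σ gS y)) = - y - σ gS y - σ gT (σ gS y) := by
      rw [← e0]
      have := rel (show gS * gT * gS = gT * gT * gS * gT * gT by decide) y
      simpa [ht] using this
    refine iso_of rho3 σ hσ f ?_ ?_ ⟨![1, 0, 0], by simpa [hf] using hy⟩
    · intro v
      rw [hf, hf, rho3T]
      simp only [map_add, map_sub, map_smul, ht, e0, Matrix.cons_val]
      linear_combination (norm := module) v 2 • three (y + σ gS y - σ gT (σ gS y)) -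
        v 1 • three (σ gT (σ gS y)) 
    · intro v
      rw [hf, hf, rho3S]
      simp only [map_add, map_sub, map_smul, hz, e1, Matrix.cons_val]
      linear_combination (norm := module) - v 1 • three (y + σ gS y)

lemma card1 : Nat.card rho1.asModule = 3 := by
  change Nat.card (ZMod 3) = 3
  simp
lemma card2 : Nat.card rho2.asModule = 9 := by
  change Nat.card (Fin 2 → ZMod 3) = 9
  simp
lemma card3 : Nat.card rho3.asModule = 27 := by
  change Nat.card (Fin 3 → ZMod 3) = 27
  simp

theorem stmt13 :
    ∃ (V₁ V₂ V₃ : Type) (_ : AddCommGroup V₁) (_ : Module F₃SL₂F₃ V₁)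
      (_ : AddCommGroup V₂) (_ : Module F₃SL₂F₃ V₂)
      (_ : AddCommGroup V₃) (_ : Module F₃SL₂F₃ V₃),
      IsSimpleModule F₃SL₂F₃ V₁ ∧ IsSimpleModule F₃SL₂F₃ V₂ ∧ IsSimpleModule F₃SL₂F₃ V₃ ∧
      IsEmpty (V₁ ≃ₗ[F₃SL₂F₃] V₂) ∧ IsEmpty (V₁ ≃ₗ[F₃SL₂F₃] V₃) ∧ IsEmpty (V₂ ≃ₗ[F₃SL₂F₃] V₃) ∧
      ∀ (U : Type u) [AddCommGroup U] [Module F₃SL₂F₃ U], IsSimpleModule F₃SL₂F₃ U →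
        (Nonempty (U ≃ₗ[F₃SL₂F₃] V₁) ∨ Nonempty (U ≃ₗ[F₃SL₂F₃] V₂) ∨
          Nonempty (U ≃ₗ[F₃SL₂F₃] V₃)) := by
  refine ⟨rho1.asModule, rho2.asModule, rho3.asModule, inferInstance, inferInstance,
    inferInstance, inferInstance, inferInstance, inferInstance, simple1, simple2, simple3,
    ⟨fun e => ?_⟩, ⟨fun e => ?_⟩, ⟨fun e => ?_⟩, fun U _ _ _ => classify U⟩
  · have := Nat.card_congr e.toEquiv
    simp [card1, card2] at this
  · have := Nat.card_congr e.toEquiv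
    simp [card1, card3] at this
  · have := Nat.card_congr e.toEquiv
    simp [card2, card3] at this
end
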